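/- arXiv:0808.3442 — 2 statements merged into one kernel-verified Lean document; each statement's English description precedes it below -/
import Mathlib

section
/- For the two-dimensional Ising model on the periodic L_1 × L_2 square lattice with couplings a, b > 0 in the high-temperature regime ā > b, the alternating sum satisfies lim_{L_2→∞} Σ_{k=0}^{2L_2−1} (−1)^{k+1} γ_k = 0 (indeed this sum is O(1/L_2) for large L_2); consequently lim_{L_2→∞} lim_{L_1→∞} (1 − Z_Λ^(−)/Z_Λ)^{1/L_1} = e^{−γ_0} with γ_0 = 2(ā − b), the exact inverse correlation length of the model. -/
/-!
The two-dimensional Ising model on the periodic `L1 × L2` square lattice.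
Spins `σ_x = ±1` are encoded by `Bool` via `spinv`; `cyc i j` is cyclic translation of
`i : Fin m` by `j` steps.  `ZI` is the periodic partition function with horizontal
coupling `a` and vertical coupling `b` (including the normalization `2^{-L1 L2}` of the
counting measure); `ZIm` is the partition function with the sign of the horizontal
coupling reversed on all horizontal links of the fixed column crossing the boundary
(i.e. antiperiodic boundary conditions in the first direction); `corrI` is the
two-point function `⟨σ_x σ_y⟩_Λ`.
-/

namespace TYIsing

/-- Cyclic shift on `Fin m` by `j` steps. -/
def cyc {m : ℕ} (i : Fin m) (j : ℕ) : Fin m := ⟨(i.val + j) % m, Nat.mod_lt _ i.pos⟩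

/-- The Ising spin value `±1` encoded by a Boolean. -/
def spinv (s : Bool) : ℝ := if s then 1 else -1

/-- Periodic Ising partition function on the `L1 × L2` torus. -/
noncomputable def ZI (L1 L2 : ℕ) (a b : ℝ) : ℝ :=
  ∑ σ : Fin L1 × Fin L2 → Bool, ((2 : ℝ)⁻¹) ^ (L1 * L2) *
    Real.exp (∑ x : Fin L1 × Fin L2,
      (a * spinv (σ x) * spinv (σ (cyc x.1 1, x.2)) +
        b * spinv (σ x) * spinv (σ (x.1, cyc x.2 1))))

/-- Twisted (antiperiodic in the first direction) Ising partition function: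
the coupling `a` is reversed in sign on the horizontal links of the column crossing
the boundary. -/
noncomputable def ZIm (L1 L2 : ℕ) (a b : ℝ) : ℝ :=
  ∑ σ : Fin L1 × Fin L2 → Bool, ((2 : ℝ)⁻¹) ^ (L1 * L2) *
    Real.exp (∑ x : Fin L1 × Fin L2,
      ((if x.1.val + 1 = L1 then -a else a) * spinv (σ x) * spinv (σ (cyc x.1 1, x.2)) +
        b * spinv (σ x) * spinv (σ (x.1, cyc x.2 1))))

/-- The finite-volume two-point function `⟨σ_x σ_y⟩_Λ`. -/
noncomputable def corrI (L1 L2 : ℕ) (a b : ℝ) (x y : Fin L1 × Fin L2) : ℝ :=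
  (∑ σ : Fin L1 × Fin L2 → Bool, ((2 : ℝ)⁻¹) ^ (L1 * L2) * spinv (σ x) * spinv (σ y) *
      Real.exp (∑ w : Fin L1 × Fin L2,
        (a * spinv (σ w) * spinv (σ (cyc w.1 1, w.2)) +
          b * spinv (σ w) * spinv (σ (w.1, cyc w.2 1))))) / ZI L1 L2 a b

end TYIsing

namespace TYIsing

section Fermion

variable {H ι : Type*} [AddCommGroup H] [Module ℂ H]

/-- Canonical anticommutation relations between creation operators `η` and
annihilation operators `ξ`. -/
structure IsCAR (η ξ : ι → Module.End ℂ H) : Prop where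
  create : ∀ i j, η i * η j + η j * η i = 0
  annihilate : ∀ i j, ξ i * ξ j + ξ j * ξ i = 0
  mixed : ∀ i j, i ≠ j → ξ i * η j + η j * ξ i = 0
  diag : ∀ i, ξ i * η i + η i * ξ i = 1

/-- The projection onto the states annihilated by all `ξ k` with `k` in the list `l`. -/
def vacuum (η ξ : ι → Module.End ℂ H) (l : List ι) : Module.End ℂ H :=
  (l.map fun k => ξ k * η k).prod

variable {η ξ : ι → Module.End ℂ H}

lemma IsCAR.commute_create (h : IsCAR η ξ) {i j : ι} (hij : i ≠ j) :
    Commute (η i) (ξ j * η j) := by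
  have h1 := h.mixed j i hij.symm
  have h2 := h.create i j
  rw [add_eq_zero_iff_eq_neg] at h1 h2
  have h3 : η i * ξ j = -(ξ j * η i) := by rw [h1, neg_neg]
  rw [commute_iff_eq, ← mul_assoc, h3, neg_mul, mul_assoc, h2, mul_neg, neg_neg, mul_assoc]

lemma IsCAR.commute_annihilate (h : IsCAR η ξ) {i j : ι} (hij : i ≠ j) :
    Commute (ξ i) (ξ j * η j) := by
  have h1 := h.mixed i j hij
  have h2 := h.annihilate i j
  rw [add_eq_zero_iff_eq_neg] at h1 h2
  simp only [commute_iff_eq]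
  rw [← mul_assoc, h2, mul_assoc, neg_mul, mul_assoc, h1, mul_neg, neg_neg]

lemma IsCAR.idem (h : IsCAR η ξ) (i : ι) : (ξ i * η i) * (ξ i * η i) = ξ i * η i := by
  have h1 := h.create i i
  have h2 : η i * η i = 0 := by
    have : (2 : ℂ) • (η i * η i) = 0 := by rw [two_smul]; exact h1
    simpa using this
  have h3 := eq_sub_of_add_eq' (h.diag i)
  calc _ = ξ i * (η i * ξ i) * η i := by noncomm_ring
    _ = ξ i * η i - ξ i * ξ i * (η i * η i) := by rw [h3]; noncomm_ring
    _ = _ := by rw [h2]; simp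

lemma commute_vacuum {W : Module.End ℂ H} {l : List ι}
    (hW : ∀ k ∈ l, Commute W (ξ k * η k)) : Commute W (vacuum η ξ l) :=
  Commute.list_prod_right _ _ (by simpa using hW)

lemma IsCAR.vacuum_idem (h : IsCAR η ξ) {l : List ι} (hl : l.Nodup) :
    vacuum η ξ l * vacuum η ξ l = vacuum η ξ l := by
  induction l with
  | nil => simp [vacuum]
  | cons k l ih =>
    rw [List.nodup_cons] at hl
    have hc : Commute (ξ k * η k) (vacuum η ξ l) := by
      refine commute_vacuum fun j hj => ?_
      have hkj : k ≠ j := fun e => hl.1 (e ▸ hj)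
      exact (h.commute_annihilate hkj).mul_left (h.commute_create hkj)
    have e : vacuum η ξ (k :: l) = (ξ k * η k) * vacuum η ξ l := by simp [vacuum]
    rw [e]
    calc _ = (ξ k * η k) * (vacuum η ξ l * (ξ k * η k)) * vacuum η ξ l := by noncomm_ring
      _ = ((ξ k * η k) * (ξ k * η k)) * (vacuum η ξ l * vacuum η ξ l) := by
        rw [← hc.eq]; noncomm_ring
      _ = _ := by rw [h.idem, ih hl.2]

/-- Trace of an operator that rescales every creation operator, in terms of its vacuum value. -/
lemma IsCAR.trace_eq (h : IsCAR η ξ) {W : Module.End ℂ H} {w : ι → ℂ} {l : List ι} (hl : l.Nodup)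
    (hW : ∀ k ∈ l, W * η k = w k • (η k * W)) :
    LinearMap.trace ℂ H W =
      (l.map fun k => 1 + w k).prod * LinearMap.trace ℂ H (W * vacuum η ξ l) := by
  induction l with
  | nil => simp [vacuum]
  | cons k l ih =>
    rw [List.nodup_cons] at hl
    have hne : ∀ j ∈ l, k ≠ j := fun j hj e => hl.1 (e ▸ hj)
    have hc : Commute (ξ k * η k) (vacuum η ξ l) := commute_vacuum fun j hj =>
      (h.commute_annihilate (hne j hj)).mul_left (h.commute_create (hne j hj))
    have hc' : Commute (η k) (vacuum η ξ l) := commute_vacuum fun j hj =>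
      h.commute_create (hne j hj)
    have e : vacuum η ξ (k :: l) = (ξ k * η k) * vacuum η ξ l := by simp [vacuum]
    rw [ih hl.2 fun j hj => hW j (List.mem_cons_of_mem _ hj), e, hc.eq, ← mul_assoc]
    set W' := W * vacuum η ξ l with hW'
    have hk : W' * η k = w k • (η k * W') := by
      rw [hW', mul_assoc, ← hc'.eq, ← mul_assoc, hW k List.mem_cons_self, smul_mul_assoc, mul_assoc]
    have h1 : LinearMap.trace ℂ H W' = LinearMap.trace ℂ H (W' * (ξ k * η k)) +
        LinearMap.trace ℂ H (W' * (η k * ξ k)) := by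
      rw [← map_add, ← mul_add, h.diag, mul_one]
    have h2 : LinearMap.trace ℂ H (W' * (η k * ξ k)) =
        w k * LinearMap.trace ℂ H (W' * (ξ k * η k)) := by
      rw [← mul_assoc, hk, smul_mul_assoc, map_smul, smul_eq_mul, mul_assoc,
        LinearMap.trace_mul_comm, mul_assoc]
    rw [List.map_cons, List.prod_cons, h1, h2]
    ring

/-- Every operator commuting with a rank one projection acts on it as a scalar. -/
lemma exists_mul_eq_smul_of_trace_eq_one [FiniteDimensional ℂ H] {Q : Module.End ℂ H}
    (hQ : Q * Q = Q) (ht : LinearMap.trace ℂ H Q = 1) {M : Module.End ℂ H} (hM : Commute M Q) :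
    ∃ c : ℂ, M * Q = c • Q := by
  have hp : LinearMap.IsProj (LinearMap.range Q) Q :=
    (LinearMap.isProj_range_iff_isIdempotentElem Q).2 hQ
  have hr : Module.finrank ℂ (LinearMap.range Q) = 1 := by
    have := hp.trace
    rw [ht] at this
    exact_mod_cast this.symm
  obtain ⟨v, hv, hv'⟩ := finrank_eq_one_iff'.1 hr
  obtain ⟨c, hc⟩ := hv' ⟨M v, by
    obtain ⟨u, hu⟩ := v.2
    exact ⟨M u, by rw [← hu, ← Module.End.mul_apply, ← hM.eq, Module.End.mul_apply]⟩⟩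
  have hc' : c • (v : H) = M v := congrArg Subtype.val hc
  refine ⟨c, LinearMap.ext fun x => ?_⟩
  obtain ⟨d, hd⟩ := hv' ⟨Q x, x, rfl⟩
  have hd' : d • (v : H) = Q x := congrArg Subtype.val hd
  rw [Module.End.mul_apply, LinearMap.smul_apply, ← hd', map_smul, ← hc', smul_comm]

end Fermion

section Fermion
variable {H ι : Type*} [AddCommGroup H] [Module ℂ H] {η ξ : ι → Module.End ℂ H}

/-- Spectral data of an operator `V` that rescales a full set of `2 ^ |ι|`-dimensional fermionic
modes, with a parity operator `P`: all traces are determined by the vacuum eigenvalue `C` and the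
vacuum parity `ε`. -/
lemma IsCAR.exists_trace_pow [Fintype ι] [FiniteDimensional ℂ H] (h : IsCAR η ξ)
    (hdim : LinearMap.trace ℂ H 1 = 2 ^ Fintype.card ι) {V V' P : Module.End ℂ H}
    (hVV' : V' * V = 1) (hV'V : V * V' = 1) {w : ι → ℂ} (hw : ∀ k, w k ≠ 0)
    (hη : ∀ k, V * η k = w k • (η k * V)) (hξ : ∀ k, V * ξ k = (w k)⁻¹ • (ξ k * V))
    (hPP : P * P = 1) (hPη : ∀ k, P * η k = -(η k * P)) (hPξ : ∀ k, P * ξ k = -(ξ k * P)) :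
    ∃ C ε : ℂ, ε * ε = 1 ∧ C ≠ 0 ∧
      LinearMap.trace ℂ H V' = C⁻¹ * ∏ k, (1 + (w k)⁻¹) ∧
      (∀ m : ℕ, LinearMap.trace ℂ H (V ^ m) = C ^ m * ∏ k, (1 + w k ^ m)) ∧
      ∀ m : ℕ, LinearMap.trace ℂ H (V ^ m * P) = ε * C ^ m * ∏ k, (1 - w k ^ m) := by
  classical
  set l : List ι := Finset.univ.toList with hl
  have hnd : l.Nodup := Finset.nodup_toList _
  set Q := vacuum η ξ l with hQdef
  have hprod (f : ι → ℂ) : (l.map f).prod = ∏ k, f k := Finset.prod_map_toList _ _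
  have hQ : Q * Q = Q := h.vacuum_idem hnd
  have htr : LinearMap.trace ℂ H Q = 1 := by
    have := h.trace_eq (W := 1) (w := fun _ => 1) hnd (by simp)
    rw [hprod, hdim, one_mul] at this
    norm_num at this
    exact this
  have hVQ : Commute V Q := by
    refine commute_vacuum fun k _ => ?_
    rw [commute_iff_eq, ← mul_assoc, hξ, smul_mul_assoc, mul_assoc, hη, mul_smul_comm, smul_smul,
      inv_mul_cancel₀ (hw k), one_smul, mul_assoc]
  have hPQ : Commute P Q := by
    refine commute_vacuum fun k _ => ?_
    rw [commute_iff_eq, ← mul_assoc, hPξ, neg_mul, mul_assoc, hPη, mul_neg, neg_neg, mul_assoc]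
  obtain ⟨C, hC⟩ := exists_mul_eq_smul_of_trace_eq_one hQ htr hVQ
  obtain ⟨ε, hε⟩ := exists_mul_eq_smul_of_trace_eq_one hQ htr hPQ
  have hV'Q : C • (V' * Q) = Q := by
    rw [← mul_smul_comm, ← hC, ← mul_assoc, hVV', one_mul]
  have hC0 : C ≠ 0 := by
    rintro rfl
    rw [zero_smul] at hV'Q
    rw [← hV'Q, map_zero] at htr
    exact zero_ne_one htr
  have hpow (m : ℕ) : V ^ m * Q = C ^ m • Q := by
    induction m with
    | zero => simp
    | succ m ih => rw [pow_succ, mul_assoc, hC, mul_smul_comm, ih, smul_smul, pow_succ, mul_comm]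
  have hpowη (m : ℕ) (k : ι) : V ^ m * η k = w k ^ m • (η k * V ^ m) := by
    induction m with
    | zero => simp
    | succ m ih =>
      rw [pow_succ, mul_assoc, hη, mul_smul_comm, ← mul_assoc, ih, smul_mul_assoc, smul_smul,
        mul_assoc, pow_succ, mul_comm]
  refine ⟨C, ε, ?_, hC0, ?_, fun m => ?_, fun m => ?_⟩
  · have : (ε * ε) • Q = Q := by
      rw [mul_smul, ← hε, ← mul_smul_comm, ← hε, ← mul_assoc, hPP, one_mul]
    have := congrArg (LinearMap.trace ℂ H) this
    rwa [map_smul, htr, smul_eq_mul, mul_one] at this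
  · have h1 (k : ι) : V' * η k = (w k)⁻¹ • (η k * V') := by
      have h2 : V' * (V * η k) * V' = w k • (V' * η k * V * V') := by
        rw [hη, mul_smul_comm, smul_mul_assoc]; simp only [mul_assoc]
      rw [← mul_assoc, hVV', one_mul, mul_assoc _ V, hV'V, mul_one] at h2
      rw [h2, smul_smul, inv_mul_cancel₀ (hw k), one_smul]
    rw [h.trace_eq hnd (fun k _ => h1 k), hprod, mul_comm]
    congr 1
    have := congrArg (LinearMap.trace ℂ H) hV'Q
    rw [map_smul, htr, smul_eq_mul] at this
    exact eq_inv_of_mul_eq_one_right this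
  · rw [h.trace_eq hnd (fun k _ => hpowη m k), hprod, ← hQdef, hpow, map_smul, htr, smul_eq_mul,
      mul_one, mul_comm]
  · have h1 (k : ι) : V ^ m * P * η k = (-w k ^ m) • (η k * (V ^ m * P)) := by
      rw [mul_assoc, hPη, mul_neg, ← mul_assoc, hpowη, smul_mul_assoc, neg_smul, mul_assoc]
    rw [h.trace_eq hnd (fun k _ => h1 k), hprod, ← hQdef, mul_assoc, hε, mul_smul_comm, hpow,
      map_smul, map_smul, htr, smul_eq_mul, smul_eq_mul, mul_one, mul_comm]
    simp only [sub_eq_add_neg]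
end Fermion

section Clifford
variable {A : Type*} [Ring A]

lemma list_prod_mul_eq {ι : Type*} {f : ι → A} {u u' : A} {l : List ι} {j : ι} (hl : l.Nodup)
    (hj : j ∈ l) (h : f j * u = u' * f j) (hu : ∀ i ∈ l, i ≠ j → Commute (f i) u)
    (hu' : ∀ i ∈ l, i ≠ j → Commute (f i) u') :
    (l.map f).prod * u = u' * (l.map f).prod := by
  induction l with
  | nil => simp at hj
  | cons k l ih =>
    rw [List.nodup_cons] at hl
    rw [List.map_cons, List.prod_cons]
    rcases eq_or_ne k j with rfl | hkj
    · have hc : Commute (l.map f).prod u := by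
        refine Commute.list_prod_left _ _ ?_
        simp only [List.mem_map, forall_exists_index, and_imp, forall_apply_eq_imp_iff₂]
        exact fun i hi => hu i (List.mem_cons_of_mem _ hi) fun e => hl.1 (e ▸ hi)
      rw [mul_assoc, hc.eq, ← mul_assoc, h, mul_assoc]
    · have hj' : j ∈ l := (List.mem_cons.1 hj).resolve_left hkj.symm
      rw [mul_assoc, ih hl.2 hj' (fun i hi => hu i (List.mem_cons_of_mem _ hi))
        (fun i hi => hu' i (List.mem_cons_of_mem _ hi)), ← mul_assoc,
        (hu' k List.mem_cons_self hkj).eq, mul_assoc]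

lemma commute_mul_of_anticommute {x y u : A} (hx : x * u + u * x = 0) (hy : y * u + u * y = 0) :
    Commute (x * y) u := by
  rw [add_eq_zero_iff_eq_neg] at hx hy
  rw [commute_iff_eq, mul_assoc, hy, mul_neg, ← mul_assoc, hx, neg_mul, neg_neg, mul_assoc]

variable [Algebra ℂ A]

/-- Generators `p j`, `q j` (`j < n`) of a Clifford algebra with `p j ^ 2 = 1`, `q j ^ 2 = -1`. -/
structure IsClifford (n : ℕ) (p q : ℕ → A) : Prop where
  pp : ∀ i < n, ∀ j < n, p i * p j + p j * p i = if i = j then 2 else 0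
  qq : ∀ i < n, ∀ j < n, q i * q j + q j * q i = if i = j then -2 else 0
  pq : ∀ i < n, ∀ j < n, p i * q j + q j * p i = 0

/-- The product over `j < n` of the pair rotations `c + s p_j q_j`. -/
noncomputable def pairRot (n : ℕ) (p q : ℕ → A) (c s : ℂ) : A :=
  ((List.range n).map fun j => algebraMap ℂ A c + s • (p j * q j)).prod

lemma mul_self_of_add_self {x : A} {r : ℂ} (h : x * x + x * x = algebraMap ℂ A (2 * r)) :
    x * x = algebraMap ℂ A r := by
  have h1 : (2 : ℂ) • (x * x) = (2 : ℂ) • algebraMap ℂ A r := by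
    rw [two_smul, h, Algebra.smul_def, map_mul]
  exact smul_right_injective A two_ne_zero h1

namespace IsClifford
variable {n : ℕ} {p q : ℕ → A}

lemma p_sq (h : IsClifford n p q) {j : ℕ} (hj : j < n) : p j * p j = 1 := by
  rw [mul_self_of_add_self (r := 1), map_one]
  rw [mul_one, map_ofNat]
  simpa using h.pp j hj j hj

lemma q_sq (h : IsClifford n p q) {j : ℕ} (hj : j < n) : q j * q j = -1 := by
  rw [mul_self_of_add_self (r := -1), map_neg, map_one]
  rw [mul_neg_one, map_neg, map_ofNat]
  simpa using h.qq j hj j hj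

lemma commute_pair (h : IsClifford n p q) {i j : ℕ} (hi : i < n) (hj : j < n) (hij : i ≠ j)
    (c s x y : ℂ) :
    Commute (algebraMap ℂ A c + s • (p i * q i)) (x • p j + y • q j) := by
  have h1 : Commute (p i * q i) (p j) := commute_mul_of_anticommute
    (by simpa [hij] using h.pp i hi j hj) (by rw [add_comm]; exact h.pq j hj i hi)
  have h2 : Commute (p i * q i) (q j) := commute_mul_of_anticommute
    (h.pq i hi j hj) (by simpa [hij] using h.qq i hi j hj)
  refine (Algebra.commute_algebraMap_left c _).add_left (Commute.smul_left ?_ _)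
  exact (h1.smul_right _).add_right (h2.smul_right _)

lemma pair_mul_p (h : IsClifford n p q) {j : ℕ} (hj : j < n) {c s : ℂ} (hcs : c ^ 2 - s ^ 2 = 1) :
    (algebraMap ℂ A c + s • (p j * q j)) * p j =
      ((c ^ 2 + s ^ 2) • p j + (-(2 * c * s)) • q j) * (algebraMap ℂ A c + s • (p j * q j)) := by
  have e1 : q j * p j = -(p j * q j) := eq_neg_of_add_eq_zero_right (h.pq j hj j hj)
  have e2 : p j * q j * p j = - q j := by
    rw [mul_assoc, e1, mul_neg, ← mul_assoc, h.p_sq hj, one_mul]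
  have e3 : p j * (p j * q j) = q j := by rw [← mul_assoc, h.p_sq hj, one_mul]
  have e4 : q j * (p j * q j) = p j := by
    rw [← mul_assoc, e1, neg_mul, mul_assoc, h.q_sq hj, mul_neg, mul_one, neg_neg]
  simp only [Algebra.algebraMap_eq_smul_one, add_mul, mul_add, smul_mul_assoc, mul_smul_comm,
    one_mul, mul_one, e2, e3, e4]
  linear_combination (norm := module) (-(c * hcs)) • (p j) + (s * hcs) • (q j)

lemma pair_mul_q (h : IsClifford n p q) {j : ℕ} (hj : j < n) {c s : ℂ} (hcs : c ^ 2 - s ^ 2 = 1) :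
    (algebraMap ℂ A c + s • (p j * q j)) * q j =
      ((-(2 * c * s)) • p j + (c ^ 2 + s ^ 2) • q j) * (algebraMap ℂ A c + s • (p j * q j)) := by
  have e1 : q j * p j = -(p j * q j) := eq_neg_of_add_eq_zero_right (h.pq j hj j hj)
  have e2 : p j * q j * q j = - p j := by
    rw [mul_assoc, h.q_sq hj, mul_neg, mul_one]
  have e3 : p j * (p j * q j) = q j := by rw [← mul_assoc, h.p_sq hj, one_mul]
  have e4 : q j * (p j * q j) = p j := by
    rw [← mul_assoc, e1, neg_mul, mul_assoc, h.q_sq hj, mul_neg, mul_one, neg_neg]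
  simp only [Algebra.algebraMap_eq_smul_one, add_mul, mul_add, smul_mul_assoc, mul_smul_comm,
    one_mul, mul_one, e2, e3, e4]
  linear_combination (norm := module) (-(c * hcs)) • (q j) + (s * hcs) • (p j)

lemma pairRot_mul_p (h : IsClifford n p q) {j : ℕ} (hj : j < n) {c s : ℂ}
    (hcs : c ^ 2 - s ^ 2 = 1) :
    pairRot n p q c s * p j =
      ((c ^ 2 + s ^ 2) • p j + (-(2 * c * s)) • q j) * pairRot n p q c s := by
  refine list_prod_mul_eq List.nodup_range (List.mem_range.2 hj) (h.pair_mul_p hj hcs) ?_ ?_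
  · intro i hi hij
    simpa using h.commute_pair (List.mem_range.1 hi) hj hij c s 1 0
  · exact fun i hi hij => h.commute_pair (List.mem_range.1 hi) hj hij c s _ _

lemma pairRot_mul_q (h : IsClifford n p q) {j : ℕ} (hj : j < n) {c s : ℂ}
    (hcs : c ^ 2 - s ^ 2 = 1) :
    pairRot n p q c s * q j =
      ((-(2 * c * s)) • p j + (c ^ 2 + s ^ 2) • q j) * pairRot n p q c s := by
  refine list_prod_mul_eq List.nodup_range (List.mem_range.2 hj) (h.pair_mul_q hj hcs) ?_ ?_
  · intro i hi hij
    simpa using h.commute_pair (List.mem_range.1 hi) hj hij c s 0 1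
  · exact fun i hi hij => h.commute_pair (List.mem_range.1 hi) hj hij c s _ _

lemma pairRot_mul_pairRot_neg (h : IsClifford n p q) {c s : ℂ} (hcs : c ^ 2 - s ^ 2 = 1) :
    pairRot n p q c s * pairRot n p q c (-s) = 1 := by
  have key : ∀ l : List ℕ, (∀ j ∈ l, j < n) → l.Nodup →
      (l.map fun j => algebraMap ℂ A c + s • (p j * q j)).prod *
        (l.map fun j => algebraMap ℂ A c + (-s) • (p j * q j)).prod = 1 := by
    intro l
    induction l with
    | nil => simp
    | cons k l ih =>
      intro hl hnd
      rw [List.nodup_cons] at hnd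
      have hk := hl k List.mem_cons_self
      have hc : Commute (l.map fun j => algebraMap ℂ A c + s • (p j * q j)).prod
          (algebraMap ℂ A c + (-s) • (p k * q k)) := by
        refine Commute.list_prod_left _ _ ?_
        simp only [List.mem_map, forall_exists_index, and_imp, forall_apply_eq_imp_iff₂]
        intro i hi
        have hik : i ≠ k := fun e => hnd.1 (e ▸ hi)
        have hi' := hl i (List.mem_cons_of_mem _ hi)
        have h1 := h.commute_pair hi' hk hik c s 1 0
        have h2 := h.commute_pair hi' hk hik c s 0 1
        simp only [one_smul, zero_smul, add_zero, zero_add] at h1 h2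
        exact (Algebra.commute_algebraMap_right c _).add_right ((h1.mul_right h2).smul_right _)
      have hsq : (p k * q k) * (p k * q k) = 1 := by
        have e1 : q k * p k = -(p k * q k) := eq_neg_of_add_eq_zero_right (h.pq k hk k hk)
        calc _ = p k * (q k * p k) * q k := by noncomm_ring
          _ = -((p k * p k) * (q k * q k)) := by rw [e1]; noncomm_ring
          _ = 1 := by rw [h.p_sq hk, h.q_sq hk]; simp
      have h1 : (algebraMap ℂ A c + s • (p k * q k)) * (algebraMap ℂ A c + (-s) • (p k * q k)) =
          1 := by
        simp only [Algebra.algebraMap_eq_smul_one, add_mul, mul_add, smul_mul_assoc, mul_smul_comm,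
          one_mul, mul_one, hsq]
        linear_combination (norm := module) hcs • (1 : A)
      rw [List.map_cons, List.map_cons, List.prod_cons, List.prod_cons, mul_assoc,
        ← mul_assoc _ (algebraMap ℂ A c + _), hc.eq, mul_assoc,
        ih (fun j hj => hl j (List.mem_cons_of_mem _ hj)) hnd.2, mul_one, h1]
  exact key _ (fun j hj => List.mem_range.1 hj) List.nodup_range

end IsClifford

/-- Fourier mode `∑_{j<n} z^j p_j`. -/
noncomputable def mode (n : ℕ) (p : ℕ → A) (z : ℂ) : A := ∑ j ∈ Finset.range n, z ^ j • p j

namespace IsClifford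
variable {n : ℕ} {p q : ℕ → A}

lemma pairRot_mul_mode_p (h : IsClifford n p q) {c s : ℂ} (hcs : c ^ 2 - s ^ 2 = 1) (z : ℂ) :
    pairRot n p q c s * mode n p z =
      ((c ^ 2 + s ^ 2) • mode n p z + (-(2 * c * s)) • mode n q z) * pairRot n p q c s := by
  simp only [mode, Finset.smul_sum, ← Finset.sum_add_distrib, Finset.sum_mul, Finset.mul_sum]
  refine Finset.sum_congr rfl fun j hj => ?_
  rw [mul_smul_comm, h.pairRot_mul_p (Finset.mem_range.1 hj) hcs, ← smul_mul_assoc, smul_add,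
    smul_comm (z ^ j), smul_comm (z ^ j)]

lemma pairRot_mul_mode_q (h : IsClifford n p q) {c s : ℂ} (hcs : c ^ 2 - s ^ 2 = 1) (z : ℂ) :
    pairRot n p q c s * mode n q z =
      ((-(2 * c * s)) • mode n p z + (c ^ 2 + s ^ 2) • mode n q z) * pairRot n p q c s := by
  simp only [mode, Finset.smul_sum, ← Finset.sum_add_distrib, Finset.sum_mul, Finset.mul_sum]
  refine Finset.sum_congr rfl fun j hj => ?_
  rw [mul_smul_comm, h.pairRot_mul_q (Finset.mem_range.1 hj) hcs, ← smul_mul_assoc, smul_add,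
    smul_comm (z ^ j), smul_comm (z ^ j)]

/-- The generators `p_{j+1}` with the twisted boundary condition `p_n = -s p_0`. -/
noncomputable def shiftGen (n : ℕ) (s : ℂ) (p : ℕ → A) (j : ℕ) : A :=
  if j + 1 = n then (-s) • p 0 else p (j + 1)

lemma shift (h : IsClifford n p q) {s : ℂ} (hs : s * s = 1) : IsClifford n (shiftGen n s p) q where
  pp i hi j hj := by
    unfold shiftGen
    split_ifs with h1 h2 h3 h4 h5 h6
    · have := h.pp 0 (by omega) 0 (by omega)
      simp only [smul_mul_smul_comm, neg_mul_neg, hs, one_smul]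
      simpa using this
    · omega
    · omega
    · have := h.pp 0 (by omega) (j + 1) (by omega)
      simp only [smul_mul_assoc, mul_smul_comm, ← smul_add, this]
      simp
    · omega
    · have := h.pp (i + 1) (by omega) 0 (by omega)
      simp only [smul_mul_assoc, mul_smul_comm, ← smul_add, this]
      simp
    · rename_i h6
      subst h6
      simpa using h.pp (i + 1) (by omega) (i + 1) (by omega)
    · rename_i h6
      simpa [h6] using h.pp (i + 1) (by omega) (j + 1) (by omega)
  qq := h.qq
  pq i hi j hj := by
    unfold shiftGen
    split_ifs with h1
    · have := h.pq 0 (by omega) j hj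
      simp only [smul_mul_assoc, mul_smul_comm, ← smul_add, this]
      simp
    · exact h.pq (i + 1) (by omega) j hj

lemma mode_shiftGen (hn : 0 < n) {s z : ℂ} (hs : s * s = 1) (hz : z ^ n = -s) :
    z • mode n (shiftGen n s p) z = mode n p z := by
  obtain ⟨m, rfl⟩ : ∃ m, n = m + 1 := ⟨n - 1, by omega⟩
  rw [mode, Finset.sum_range_succ, mode, Finset.sum_range_succ']
  rw [smul_add, Finset.smul_sum]
  congr 1
  · refine Finset.sum_congr rfl fun j hj => ?_
    have : j + 1 ≠ m + 1 := by have := Finset.mem_range.1 hj; omega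
    rw [shiftGen, if_neg this, smul_smul, pow_succ' z j]
  · rw [shiftGen, if_pos rfl, smul_smul, smul_smul, ← pow_succ', hz, neg_mul_neg, hs, pow_zero]

lemma mode_pp (h : IsClifford n p q) (z y : ℂ) :
    mode n p z * mode n p y + mode n p y * mode n p z =
      algebraMap ℂ A (2 * ∑ j ∈ Finset.range n, (z * y) ^ j) := by
  have e : mode n p y * mode n p z =
      ∑ i ∈ Finset.range n, ∑ j ∈ Finset.range n, (z ^ i * y ^ j) • (p j * p i) := by
    rw [mode, mode, Finset.sum_mul_sum, Finset.sum_comm]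
    refine Finset.sum_congr rfl fun i _ => Finset.sum_congr rfl fun j _ => ?_
    rw [smul_mul_smul_comm, mul_comm (y ^ j)]
  rw [e, mode, mode, Finset.sum_mul_sum, ← Finset.sum_add_distrib, Finset.mul_sum, map_sum]
  refine Finset.sum_congr rfl fun i hi => ?_
  rw [← Finset.sum_add_distrib]
  rw [Finset.sum_eq_single_of_mem i hi]
  · have := h.pp i (Finset.mem_range.1 hi) i (Finset.mem_range.1 hi)
    rw [smul_mul_smul_comm, ← smul_add, this, if_pos rfl, mul_pow, Algebra.smul_def, mul_comm 2,
      map_mul _ _ (2 : ℂ), map_ofNat]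
  · intro j hj hji
    have := h.pp i (Finset.mem_range.1 hi) j (Finset.mem_range.1 hj)
    rw [smul_mul_smul_comm, ← smul_add, this, if_neg hji.symm, smul_zero]

lemma mode_qq (h : IsClifford n p q) (z y : ℂ) :
    mode n q z * mode n q y + mode n q y * mode n q z =
      algebraMap ℂ A (-(2 * ∑ j ∈ Finset.range n, (z * y) ^ j)) := by
  have e : mode n q y * mode n q z =
      ∑ i ∈ Finset.range n, ∑ j ∈ Finset.range n, (z ^ i * y ^ j) • (q j * q i) := by
    rw [mode, mode, Finset.sum_mul_sum, Finset.sum_comm]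
    refine Finset.sum_congr rfl fun i _ => Finset.sum_congr rfl fun j _ => ?_
    rw [smul_mul_smul_comm, mul_comm (y ^ j)]
  rw [e, mode, mode, Finset.sum_mul_sum, ← Finset.sum_add_distrib, Finset.mul_sum,
    ← Finset.sum_neg_distrib, map_sum]
  refine Finset.sum_congr rfl fun i hi => ?_
  rw [← Finset.sum_add_distrib]
  rw [Finset.sum_eq_single_of_mem i hi]
  · have := h.qq i (Finset.mem_range.1 hi) i (Finset.mem_range.1 hi)
    rw [smul_mul_smul_comm, ← smul_add, this, if_pos rfl, mul_pow, Algebra.smul_def, mul_comm 2,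
      ← mul_neg, map_mul _ _ (-2 : ℂ), map_neg, map_ofNat]
  · intro j hj hji
    have := h.qq i (Finset.mem_range.1 hi) j (Finset.mem_range.1 hj)
    rw [smul_mul_smul_comm, ← smul_add, this, if_neg hji.symm, smul_zero]

lemma mode_pq (h : IsClifford n p q) (z y : ℂ) :
    mode n p z * mode n q y + mode n q y * mode n p z = 0 := by
  have e : mode n q y * mode n p z =
      ∑ i ∈ Finset.range n, ∑ j ∈ Finset.range n, (z ^ i * y ^ j) • (q j * p i) := by
    rw [mode, mode, Finset.sum_mul_sum, Finset.sum_comm]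
    refine Finset.sum_congr rfl fun i _ => Finset.sum_congr rfl fun j _ => ?_
    rw [smul_mul_smul_comm, mul_comm (y ^ j)]
  rw [e, mode, mode, Finset.sum_mul_sum, ← Finset.sum_add_distrib]
  refine Finset.sum_eq_zero fun i hi => ?_
  rw [← Finset.sum_add_distrib]
  refine Finset.sum_eq_zero fun j hj => ?_
  rw [smul_mul_smul_comm, ← smul_add, h.pq i (Finset.mem_range.1 hi) j (Finset.mem_range.1 hj),
    smul_zero]

/-- The anticommutator of two linear combinations of Fourier modes is a scalar. -/
lemma mode_anticomm (h : IsClifford n p q) (z z' x y x' y' : ℂ) :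
    (x • mode n p z + y • mode n q z) * (x' • mode n p z' + y' • mode n q z') +
      (x' • mode n p z' + y' • mode n q z') * (x • mode n p z + y • mode n q z) =
      algebraMap ℂ A (2 * (x * x' - y * y') * ∑ j ∈ Finset.range n, (z * z') ^ j) := by
  have h1 := h.mode_pp z z'
  have h2 := h.mode_qq z z'
  have h3 := h.mode_pq z z'
  have h4 := h.mode_pq z' z
  rw [Algebra.algebraMap_eq_smul_one] at h1 h2 ⊢
  simp only [add_mul, mul_add, smul_mul_assoc, mul_smul_comm]
  linear_combination (norm := module) (x * x') • h1 + (y * y') • h2 + (x * y') • h3 + (y * x') • h4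

end IsClifford
end Clifford

section Modes
variable {H : Type*} [AddCommGroup H] [Module ℂ H]

lemma add_eq_zero_of_rescale {V X Y : Module.End ℂ H} {r x y : ℂ}
    (hXY : X * Y + Y * X = algebraMap ℂ _ r) (hV : V ≠ 0) (hx : V * X = x • (X * V))
    (hy : V * Y = y • (Y * V)) (hxy : x * y ≠ 1) : X * Y + Y * X = 0 := by
  have h1 : V * (X * Y + Y * X) = (x * y) • ((X * Y + Y * X) * V) := by
    rw [mul_add, ← mul_assoc, ← mul_assoc, hx, hy, smul_mul_assoc, smul_mul_assoc, mul_assoc,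
      mul_assoc, hx, hy, mul_smul_comm, mul_smul_comm, smul_smul, smul_smul, mul_comm y x,
      ← smul_add, ← mul_assoc, ← mul_assoc, add_mul]
  rw [hXY, ← Algebra.commutes, Algebra.algebraMap_eq_smul_one, smul_mul_assoc, one_mul,
    smul_smul, ← sub_eq_zero, ← sub_smul, smul_eq_zero] at h1
  have h2 : r * (1 - x * y) = 0 := by
    rcases h1 with h1 | h1
    · linear_combination h1
    · exact absurd h1 hV
  have h3 : r = 0 := (mul_eq_zero.1 h2).resolve_right (sub_ne_zero.2 hxy.symm)
  rw [hXY, h3, map_zero]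

/-- Diagonalisation of the conjugation action of an operator that acts on the Fourier modes of a
Clifford algebra by unimodular `2 × 2` blocks. -/
lemma IsClifford.exists_isCAR {n : ℕ} {p q : ℕ → Module.End ℂ H} (h : IsClifford n p q)
    {V : Module.End ℂ H} (hV : V ≠ 0) {z α α' β β' w : Fin n → ℂ}
    (horth : ∀ k l, ∑ j ∈ Finset.range n, (z k * (z l)⁻¹) ^ j = if k = l then (n : ℂ) else 0)
    (hp : ∀ k, V * mode n p (z k) = (α k • mode n p (z k) + β k • mode n q (z k)) * V)
    (hq : ∀ k, V * mode n q (z k) = (β' k • mode n p (z k) + α' k • mode n q (z k)) * V)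
    (hp' : ∀ k, V * mode n p (z k)⁻¹ = (α' k • mode n p (z k)⁻¹ + β' k • mode n q (z k)⁻¹) * V)
    (hq' : ∀ k, V * mode n q (z k)⁻¹ = (β k • mode n p (z k)⁻¹ + α k • mode n q (z k)⁻¹) * V)
    (hdet : ∀ k, α k * α' k - β k * β' k = 1) (htr : ∀ k, α k + α' k = w k + (w k)⁻¹)
    (hw0 : ∀ k, w k ≠ 0) (hw1 : ∀ k l, w k * w l ≠ 1) (hβ : ∀ k, β k ≠ 0) (hβ' : ∀ k, β' k ≠ 0) :
    ∃ x y u v : Fin n → ℂ,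
      IsCAR (fun k => x k • mode n p (z k) + y k • mode n q (z k))
        (fun k => u k • mode n p (z k)⁻¹ + v k • mode n q (z k)⁻¹) ∧
      (∀ k, V * (x k • mode n p (z k) + y k • mode n q (z k)) =
        w k • ((x k • mode n p (z k) + y k • mode n q (z k)) * V)) ∧
      ∀ k, V * (u k • mode n p (z k)⁻¹ + v k • mode n q (z k)⁻¹) =
        (w k)⁻¹ • ((u k • mode n p (z k)⁻¹ + v k • mode n q (z k)⁻¹) * V) := by
  have hn (k : Fin n) : (n : ℂ) ≠ 0 := by
    have := k.pos
    exact_mod_cast this.ne'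
  have hchar (k) : (w k - α k) * (w k - α' k) = β k * β' k := by
    have h1 := hdet k
    have h2 := htr k
    have h3 := mul_inv_cancel₀ (hw0 k)
    linear_combination (-w k) * h2 + h1 - h3
  have hchar' (k) : ((w k)⁻¹ - α k) * ((w k)⁻¹ - α' k) = β k * β' k := by
    have h1 := hdet k
    have h2 := htr k
    have h3 := mul_inv_cancel₀ (hw0 k)
    linear_combination (-(w k)⁻¹) * h2 + h1 - h3
  have hN (k) : 2 * (β' k * β k - (w k - α k) * ((w k)⁻¹ - α' k)) * (n : ℂ) ≠ 0 := by
    have h3 := mul_inv_cancel₀ (hw0 k)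
    have e : β' k * β k - (w k - α k) * ((w k)⁻¹ - α' k) = ((w k)⁻¹ - w k) * (α k - w k) := by
      linear_combination -(hchar k)
    rw [e]
    refine mul_ne_zero (mul_ne_zero two_ne_zero (mul_ne_zero ?_ ?_)) (hn k)
    · intro h0
      exact hw1 k k (by linear_combination h3 - w k * h0)
    · intro h0
      have h4 := hchar k
      have : w k - α k = 0 := by linear_combination -h0
      rw [this, zero_mul] at h4
      exact mul_ne_zero (hβ k) (hβ' k) h4.symm
  set N := fun k => 2 * (β' k * β k - (w k - α k) * ((w k)⁻¹ - α' k)) * (n : ℂ) with hNdef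
  have hη (k) : V * (β' k • mode n p (z k) + (w k - α k) • mode n q (z k)) =
      w k • ((β' k • mode n p (z k) + (w k - α k) • mode n q (z k)) * V) := by
    rw [mul_add, mul_smul_comm, mul_smul_comm, hp, hq, ← smul_mul_assoc, ← smul_mul_assoc,
      ← smul_mul_assoc, ← add_mul]
    congr 1
    linear_combination (norm := module) (-hchar k) • mode n q (z k)
  have hξ (k) : V * (((N k)⁻¹ * β k) • mode n p (z k)⁻¹ +
        ((N k)⁻¹ * ((w k)⁻¹ - α' k)) • mode n q (z k)⁻¹) =
      (w k)⁻¹ • ((((N k)⁻¹ * β k) • mode n p (z k)⁻¹ +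
        ((N k)⁻¹ * ((w k)⁻¹ - α' k)) • mode n q (z k)⁻¹) * V) := by
    rw [mul_add, mul_smul_comm, mul_smul_comm, hp', hq', ← smul_mul_assoc, ← smul_mul_assoc,
      ← smul_mul_assoc, ← add_mul]
    congr 1
    linear_combination (norm := module) (-((N k)⁻¹ * hchar' k)) • mode n q (z k)⁻¹
  refine ⟨β', fun k => w k - α k, fun k => (N k)⁻¹ * β k, fun k => (N k)⁻¹ * ((w k)⁻¹ - α' k),
    ⟨fun i j => ?_, fun i j => ?_, fun i j hij => ?_, fun i => ?_⟩, hη, hξ⟩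
  · exact add_eq_zero_of_rescale (h.mode_anticomm _ _ _ _ _ _) hV (hη i) (hη j) (hw1 i j)
  · refine add_eq_zero_of_rescale (h.mode_anticomm _ _ _ _ _ _) hV (hξ i) (hξ j) ?_
    rw [← mul_inv]
    exact inv_ne_one.2 (hw1 i j)
  · rw [add_comm, h.mode_anticomm, horth, if_neg hij.symm, mul_zero, map_zero]
  · rw [add_comm, h.mode_anticomm, horth, if_pos rfl]
    rw [← map_one (algebraMap ℂ (Module.End ℂ H))]
    congr 1
    have := hN i
    calc _ = (N i)⁻¹ * N i := by rw [hNdef]; ring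
      _ = 1 := inv_mul_cancel₀ this
end Modes

section SpinOperators
variable {n : ℕ}

/-- The operator `f ↦ (σ ↦ c σ * f (φ σ))` on functions of a spin configuration. -/
def wop (c : (Fin n → Bool) → ℂ) (φ : (Fin n → Bool) → (Fin n → Bool)) :
    Module.End ℂ ((Fin n → Bool) → ℂ) where
  toFun f σ := c σ * f (φ σ)
  map_add' f g := by ext σ; simp [mul_add]
  map_smul' r f := by ext σ; simp [mul_left_comm]

lemma wop_apply (c : (Fin n → Bool) → ℂ) (φ : (Fin n → Bool) → (Fin n → Bool)) (f σ) :
    wop c φ f σ = c σ * f (φ σ) := rfl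

lemma wop_mul (c d : (Fin n → Bool) → ℂ) (φ ψ : (Fin n → Bool) → (Fin n → Bool)) :
    wop c φ * wop d ψ = wop (fun σ => c σ * d (φ σ)) (fun σ => ψ (φ σ)) := by
  ext f σ
  simp [wop_apply, mul_assoc]

lemma wop_one : wop (fun _ => 1) (fun σ : Fin n → Bool => σ) = 1 := by
  ext f σ
  simp [wop_apply]

lemma smul_wop (r : ℂ) (c : (Fin n → Bool) → ℂ) (φ : (Fin n → Bool) → (Fin n → Bool)) :
    r • wop c φ = wop (fun σ => r * c σ) φ := by
  ext f σ
  simp [wop_apply, mul_assoc]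

/-- Reverse the spins at all sites below `j`. -/
def flipTo (j : ℕ) (σ : Fin n → Bool) : Fin n → Bool := fun i => if i.val < j then !σ i else σ i

lemma flipTo_flipTo (j : ℕ) (σ : Fin n → Bool) : flipTo j (flipTo j σ) = σ := by
  ext i
  by_cases h : i.val < j <;> simp [flipTo, h]

lemma flipTo_comm (i j : ℕ) (σ : Fin n → Bool) :
    flipTo i (flipTo j σ) = flipTo j (flipTo i σ) := by
  ext k
  by_cases h : k.val < j <;> by_cases hk : k.val < i <;> simp [flipTo, h, hk]

/-- The value of the spin at site `j`. -/
noncomputable def sgn (j : ℕ) (σ : Fin n → Bool) : ℂ :=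
  if h : j < n then ((spinv (σ ⟨j, h⟩) : ℝ) : ℂ) else 1

lemma sgn_mul_self (j : ℕ) (σ : Fin n → Bool) : sgn j σ * sgn j σ = 1 := by
  unfold sgn spinv
  split_ifs <;> simp

lemma sgn_flipTo {i j : ℕ} (hi : i < n) (σ : Fin n → Bool) :
    sgn i (flipTo j σ) = if i < j then -sgn i σ else sgn i σ := by
  unfold sgn spinv flipTo
  by_cases h : i < j <;> cases hσ : σ ⟨i, hi⟩ <;> simp [h, hi, hσ]

/-- Even Majorana operators (Jordan-Wigner transform). -/
noncomputable def majP (n j : ℕ) : Module.End ℂ ((Fin n → Bool) → ℂ) := wop (sgn j) (flipTo j)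

/-- Odd Majorana operators (Jordan-Wigner transform). -/
noncomputable def majQ (n j : ℕ) : Module.End ℂ ((Fin n → Bool) → ℂ) :=
  wop (sgn j) (flipTo (j + 1))

/-- Reversal of all spins below site `j`. -/
def flipOp (n j : ℕ) : Module.End ℂ ((Fin n → Bool) → ℂ) := wop (fun _ => 1) (flipTo j)

lemma flipOp_mul_self (j : ℕ) : flipOp n j * flipOp n j = 1 := by
  simp [flipOp, wop_mul, flipTo_flipTo, wop_one]

lemma wop_add_eq_zero {c d : (Fin n → Bool) → ℂ} {φ ψ : (Fin n → Bool) → (Fin n → Bool)}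
    (hc : ∀ σ, c σ = -d σ) (hφ : ∀ σ, φ σ = ψ σ) : wop c φ + wop d ψ = 0 := by
  ext f σ
  simp [wop_apply, hc, hφ]

lemma wop_anticomm {i j : ℕ} (hi : i < n) (hj : j < n) {r t : ℕ} (h : ¬(i < t ↔ j < r)) :
    wop (n := n) (sgn i) (flipTo r) * wop (sgn j) (flipTo t) +
      wop (sgn j) (flipTo t) * wop (sgn i) (flipTo r) = 0 := by
  rw [wop_mul, wop_mul]
  refine wop_add_eq_zero (fun σ => ?_) (fun σ => flipTo_comm _ _ _)
  rw [sgn_flipTo hi, sgn_flipTo hj]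
  split_ifs <;> first | ring1 | (exfalso; tauto)

lemma wop_sgn_sq {i : ℕ} (hi : i < n) (r : ℕ) :
    wop (n := n) (sgn i) (flipTo r) * wop (sgn i) (flipTo r) = if i < r then -1 else 1 := by
  rw [wop_mul]
  refine LinearMap.ext fun f => funext fun σ => ?_
  rw [wop_apply, sgn_flipTo hi, flipTo_flipTo]
  have := sgn_mul_self i σ
  split_ifs with h
  · rw [mul_neg, this]; simp
  · rw [this]; simp

lemma isClifford_maj (n : ℕ) : IsClifford n (majP n) (majQ n) where
  pp i hi j hj := by
    split_ifs with h
    · subst h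
      simp [majP, wop_sgn_sq hi, one_add_one_eq_two]
    · exact wop_anticomm hi hj (by omega)
  qq i hi j hj := by
    split_ifs with h
    · subst h
      simp [majQ, wop_sgn_sq hi]
      rw [← neg_add, one_add_one_eq_two]
    · exact wop_anticomm hi hj (by omega)
  pq i hi j hj := wop_anticomm hi hj (by omega)

lemma parity_mul_majP {j : ℕ} (hj : j < n) : flipOp n n * majP n j = -(majP n j * flipOp n n) := by
  refine eq_neg_of_add_eq_zero_left ?_
  rw [flipOp, majP, wop_mul, wop_mul]
  refine wop_add_eq_zero (fun σ => ?_) (fun σ => flipTo_comm _ _ _)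
  rw [sgn_flipTo hj, if_pos hj]
  ring

lemma parity_mul_majQ {j : ℕ} (hj : j < n) : flipOp n n * majQ n j = -(majQ n j * flipOp n n) := by
  refine eq_neg_of_add_eq_zero_left ?_
  rw [flipOp, majQ, wop_mul, wop_mul]
  refine wop_add_eq_zero (fun σ => ?_) (fun σ => flipTo_comm _ _ _)
  rw [sgn_flipTo hj, if_pos hj]
  ring

lemma majP_mul_majQ {j : ℕ} (hj : j < n) :
    majP n j * majQ n j = wop (fun _ => 1) (fun σ => flipTo (j + 1) (flipTo j σ)) := by
  rw [majP, majQ, wop_mul]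
  congr 1
  ext σ
  rw [sgn_flipTo hj, if_neg (lt_irrefl j), sgn_mul_self]

lemma majP_succ_mul_majQ {j : ℕ} (hj : j + 1 < n) :
    majP n (j + 1) * majQ n j = wop (fun σ => -(sgn j σ * sgn (j + 1) σ)) (fun σ => σ) := by
  rw [majP, majQ, wop_mul]
  congr 1
  · ext σ
    rw [sgn_flipTo (by omega), if_pos (by omega)]
    ring
  · ext σ : 1
    rw [flipTo_flipTo]

lemma majP_zero_mul_majQ (m : ℕ) :
    majP (m + 1) 0 * majQ (m + 1) m = wop (fun σ => sgn 0 σ * sgn m σ) (flipTo (m + 1)) := by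
  rw [majP, majQ, wop_mul]
  congr 1

lemma trace_one_spin : LinearMap.trace ℂ ((Fin n → Bool) → ℂ) 1 = 2 ^ n := by
  simp [LinearMap.trace_one]

lemma mul_anticomm_of_commute {A : Type*} [Ring A] {g x y : A} (h : g * x = -(x * g))
    (hy : Commute g y) : g * (x * y) = -(x * y * g) := by
  rw [← mul_assoc, h, neg_mul, mul_assoc, hy.eq, mul_assoc]

section Peel
variable {H ι : Type*} [AddCommGroup H] [Module ℂ H]

lemma trace_eq_zero_of_anticomm {g R : Module.End ℂ H} (hg : g * g = 1)
    (h : g * R = -(R * g)) : LinearMap.trace ℂ H R = 0 := by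
  have h1 : LinearMap.trace ℂ H (g * R * g) = LinearMap.trace ℂ H R := by
    rw [LinearMap.trace_mul_comm, ← mul_assoc, hg, one_mul]
  rw [h, neg_mul, mul_assoc, hg, mul_one, map_neg] at h1
  have : (2 : ℂ) * LinearMap.trace ℂ H R = 0 := by linear_combination -h1
  simpa using this

variable {x g : ι → Module.End ℂ H} {c s : ℂ} {l : List ι} {R : Module.End ℂ H}

lemma commute_prod_pair {k : ι} (hk : k ∉ l) (h : ∀ i ∈ l, i ≠ k → Commute (g k) (x i)) :
    Commute (g k) (l.map fun j => algebraMap ℂ _ c + s • x j).prod := by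
  refine Commute.list_prod_right _ _ ?_
  simp only [List.mem_map, forall_exists_index, and_imp, forall_apply_eq_imp_iff₂]
  intro i hi
  have hik : i ≠ k := fun e => hk (e ▸ hi)
  exact (Algebra.commute_algebraMap_right c _).add_right ((h i hi hik).smul_right _)

lemma trace_mul_prod_of_commute (hl : l.Nodup) (hg : ∀ j ∈ l, g j * g j = 1)
    (hx : ∀ j ∈ l, g j * x j = -(x j * g j)) (hc : ∀ j ∈ l, ∀ i ∈ l, i ≠ j → Commute (g j) (x i))
    (hR : ∀ j ∈ l, Commute (g j) R) :
    LinearMap.trace ℂ H (R * (l.map fun j => algebraMap ℂ _ c + s • x j).prod) =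
      c ^ l.length * LinearMap.trace ℂ H R := by
  induction l with
  | nil => simp
  | cons k l ih =>
    rw [List.nodup_cons] at hl
    have hm {j} (hj : j ∈ l) := List.mem_cons_of_mem k hj
    have hk : k ∈ k :: l := List.mem_cons_self
    have hcm : Commute (g k) (l.map fun j => algebraMap ℂ _ c + s • x j).prod :=
      commute_prod_pair hl.1 fun i hi => hc k hk i (hm hi)
    have h0 : LinearMap.trace ℂ H
        (R * (x k * (l.map fun j => algebraMap ℂ _ c + s • x j).prod)) = 0 := by
      refine trace_eq_zero_of_anticomm (hg k hk) ?_
      rw [← mul_assoc, (hR k hk).eq, mul_assoc, ← mul_assoc (g k), hx k hk, neg_mul,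
        mul_assoc (x k), hcm.eq, mul_neg, mul_assoc, mul_assoc]
    rw [List.map_cons, List.prod_cons, add_mul, mul_add, map_add, smul_mul_assoc, mul_smul_comm,
      map_smul, h0, smul_zero, add_zero, ← Algebra.smul_def,
      mul_smul_comm, map_smul, ih hl.2 (fun j hj => hg j (hm hj)) (fun j hj => hx j (hm hj))
        (fun j hj i hi => hc j (hm hj) i (hm hi)) (fun j hj => hR j (hm hj)), List.length_cons,
      pow_succ', smul_eq_mul, mul_assoc]

lemma trace_mul_prod_of_anticommute (hl : l.Nodup) (hg : ∀ j ∈ l, g j * g j = 1)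
    (hx : ∀ j ∈ l, g j * x j = -(x j * g j)) (hc : ∀ j ∈ l, ∀ i ∈ l, i ≠ j → Commute (g j) (x i))
    (hR : ∀ j ∈ l, g j * R = -(R * g j)) :
    LinearMap.trace ℂ H (R * (l.map fun j => algebraMap ℂ _ c + s • x j).prod) =
      s ^ l.length * LinearMap.trace ℂ H (R * (l.map x).prod) := by
  induction l generalizing R with
  | nil => simp
  | cons k l ih =>
    rw [List.nodup_cons] at hl
    have hm {j} (hj : j ∈ l) := List.mem_cons_of_mem k hj
    have hk : k ∈ k :: l := List.mem_cons_self
    have hcm : Commute (g k) (l.map fun j => algebraMap ℂ _ c + s • x j).prod :=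
      commute_prod_pair hl.1 fun i hi => hc k hk i (hm hi)
    have h0 : LinearMap.trace ℂ H
        (R * (l.map fun j => algebraMap ℂ _ c + s • x j).prod) = 0 := by
      refine trace_eq_zero_of_anticomm (hg k hk) ?_
      rw [← mul_assoc, hR k hk, neg_mul, mul_assoc, hcm.eq, mul_assoc]
    have hRx : ∀ j ∈ l, g j * (R * x k) = -(R * x k * g j) := by
      intro j hj
      have hkj : k ≠ j := fun e => hl.1 (e ▸ hj)
      rw [← mul_assoc, hR j (hm hj), neg_mul, mul_assoc, (hc j (hm hj) k hk hkj).eq, mul_assoc]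
    rw [List.map_cons, List.prod_cons, add_mul, mul_add, map_add, ← Algebra.smul_def,
      mul_smul_comm, map_smul, h0, smul_zero, zero_add, smul_mul_assoc,
      mul_smul_comm, map_smul, ← mul_assoc R, ih hl.2 (fun j hj => hg j (hm hj))
        (fun j hj => hx j (hm hj)) (fun j hj i hi => hc j (hm hj) i (hm hi)) hRx, List.length_cons,
      pow_succ', smul_eq_mul, List.map_cons, List.prod_cons, mul_assoc, mul_assoc]

end Peel

lemma commute_flipOp (i j k : ℕ) :
    Commute (flipOp n k) (wop (fun _ => 1) fun σ => flipTo i (flipTo j σ)) := by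
  rw [commute_iff_eq, flipOp, wop_mul, wop_mul]
  congr 1
  ext σ : 1
  rw [flipTo_comm k, flipTo_comm k]

lemma commute_flipOp_pairRot (k : ℕ) (c s : ℂ) :
    Commute (flipOp n k) (pairRot n (majP n) (majQ n) c s) := by
  refine Commute.list_prod_right _ _ ?_
  simp only [List.mem_map, forall_exists_index, and_imp, forall_apply_eq_imp_iff₂]
  intro i hi
  rw [majP_mul_majQ (List.mem_range.1 hi)]
  exact (Algebra.commute_algebraMap_right c _).add_right ((commute_flipOp _ _ _).smul_right _)

lemma prod_majP_mul_majQ {k : ℕ} (hk : k ≤ n) :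
    ((List.range k).map fun j => majP n j * majQ n j).prod = flipOp n k := by
  induction k with
  | zero =>
    simp only [List.range_zero, List.map_nil, List.prod_nil]
    rw [flipOp, ← wop_one]
    congr 1
  | succ k ih =>
    rw [List.range_succ, List.map_append, List.prod_append, ih (by omega)]
    simp only [List.map_cons, List.map_nil, List.prod_cons, List.prod_nil, mul_one]
    rw [majP_mul_majQ (by omega), flipOp, wop_mul, flipOp]
    simp [flipTo_flipTo]

lemma prod_majP_succ_mul_majQ {k : ℕ} (hk : k < n) :
    ((List.range k).map fun j => majP n (j + 1) * majQ n j).prod =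
      wop (fun σ => (-1) ^ k * (sgn 0 σ * sgn k σ)) (fun σ => σ) := by
  induction k with
  | zero => simp [sgn_mul_self, wop_one]
  | succ k ih =>
    rw [List.range_succ, List.map_append, List.prod_append, ih (by omega)]
    simp only [List.map_cons, List.map_nil, List.prod_cons, List.prod_nil, mul_one]
    rw [majP_succ_mul_majQ hk, wop_mul]
    congr 1
    ext σ
    linear_combination (-(-1) ^ k * sgn 0 σ * sgn (k + 1) σ) * sgn_mul_self k σ

/-- The spin operator at site `j`. -/
noncomputable def spinOp (n j : ℕ) : Module.End ℂ ((Fin n → Bool) → ℂ) := wop (sgn j) fun σ => σ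

lemma spinOp_mul_self (j : ℕ) : spinOp n j * spinOp n j = 1 := by
  simp [spinOp, wop_mul, sgn_mul_self, wop_one]

lemma sgn_flipTo_flipTo {i j : ℕ} (hj : j < n) (σ : Fin n → Bool) :
    sgn j (flipTo (i + 1) (flipTo i σ)) = if i = j then -sgn j σ else sgn j σ := by
  rw [sgn_flipTo hj, sgn_flipTo hj]
  split_ifs <;> first | rfl | ring1 | omega

lemma trace_pairRot (c s : ℂ) :
    LinearMap.trace ℂ _ (pairRot n (majP n) (majQ n) c s) = 2 ^ n * c ^ n := by
  have := trace_mul_prod_of_commute (x := fun j => majP n j * majQ n j) (g := spinOp n)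
    (c := c) (s := s) (R := 1) (l := List.range n) List.nodup_range
    (fun j _ => spinOp_mul_self j) ?_ ?_ (fun j _ => Commute.one_right _)
  · rw [one_mul, trace_one_spin, List.length_range, mul_comm] at this
    exact this
  · intro j hj
    have hj := List.mem_range.1 hj
    refine eq_neg_of_add_eq_zero_left ?_
    simp only [majP_mul_majQ hj, spinOp, wop_mul]
    refine wop_add_eq_zero (fun σ => ?_) (fun σ => rfl)
    rw [sgn_flipTo_flipTo hj, if_pos rfl]
    ring
  · intro j hj i hi hij
    have hj := List.mem_range.1 hj
    have hi := List.mem_range.1 hi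
    simp only [majP_mul_majQ hi, spinOp, commute_iff_eq, wop_mul]
    congr 1
    ext σ
    rw [sgn_flipTo_flipTo hj, if_neg hij]
    ring

lemma trace_pairRot_mul_parity (c s : ℂ) :
    LinearMap.trace ℂ _ (pairRot n (majP n) (majQ n) c s * flipOp n n) = 2 ^ n * s ^ n := by
  have := trace_mul_prod_of_anticommute (x := fun j => majP n j * majQ n j) (g := spinOp n)
    (c := c) (s := s) (R := flipOp n n) (l := List.range n) List.nodup_range
    (fun j _ => spinOp_mul_self j) ?_ ?_ ?_
  · rw [prod_majP_mul_majQ le_rfl, flipOp_mul_self, trace_one_spin, List.length_range, mul_comm]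
      at this
    rw [LinearMap.trace_mul_comm]
    exact this
  · intro j hj
    have hj := List.mem_range.1 hj
    refine eq_neg_of_add_eq_zero_left ?_
    simp only [majP_mul_majQ hj, spinOp, wop_mul]
    refine wop_add_eq_zero (fun σ => ?_) (fun σ => rfl)
    rw [sgn_flipTo_flipTo hj, if_pos rfl]
    ring
  · intro j hj i hi hij
    have hj := List.mem_range.1 hj
    have hi := List.mem_range.1 hi
    simp only [majP_mul_majQ hi, spinOp, commute_iff_eq, wop_mul]
    congr 1
    ext σ
    rw [sgn_flipTo_flipTo hj, if_neg hij]
    ring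
  · intro j hj
    have hj := List.mem_range.1 hj
    refine eq_neg_of_add_eq_zero_left ?_
    simp only [flipOp, spinOp, wop_mul]
    refine wop_add_eq_zero (fun σ => ?_) (fun σ => rfl)
    rw [sgn_flipTo hj, if_pos hj]
    ring

lemma pairRot_shift_eq (m : ℕ) (τ c s : ℂ) :
    pairRot (m + 1) (IsClifford.shiftGen (m + 1) τ (majP (m + 1))) (majQ (m + 1)) c s =
      ((List.range m).map fun j => algebraMap ℂ _ c +
        s • (majP (m + 1) (j + 1) * majQ (m + 1) j)).prod *
      (algebraMap ℂ _ c + s • wop (fun σ => -τ * (sgn 0 σ * sgn m σ)) (flipTo (m + 1))) := by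
  rw [pairRot, List.range_succ, List.map_append, List.prod_append]
  congr 1
  · congr 1
    refine List.map_congr_left fun j hj => ?_
    have : j + 1 ≠ m + 1 := by have := List.mem_range.1 hj; omega
    rw [IsClifford.shiftGen, if_neg this]
  · simp only [List.map_cons, List.map_nil, List.prod_cons, List.prod_nil, mul_one]
    rw [IsClifford.shiftGen, if_pos rfl, smul_mul_assoc, majP_zero_mul_majQ, smul_wop]

lemma trace_pairRot_shift_mul (hn : 0 < n) (τ c s : ℂ) {Y : Module.End ℂ ((Fin n → Bool) → ℂ)}
    (hY : ∀ k, Commute (flipOp n k) Y) :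
    LinearMap.trace ℂ _ (pairRot n (IsClifford.shiftGen n τ (majP n)) (majQ n) c (-s) * Y) =
      c ^ n * LinearMap.trace ℂ _ Y + τ * s ^ n * LinearMap.trace ℂ _ (Y * flipOp n n) := by
  obtain ⟨m, rfl⟩ : ∃ m, n = m + 1 := ⟨n - 1, by omega⟩
  set L : Module.End ℂ ((Fin (m + 1) → Bool) → ℂ) :=
    wop (fun σ => -τ * (sgn 0 σ * sgn m σ)) (flipTo (m + 1)) with hL
  have hx : ∀ j ∈ List.range m, flipOp (m + 1) (j + 1) * (majP (m + 1) (j + 1) * majQ (m + 1) j) =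
      -(majP (m + 1) (j + 1) * majQ (m + 1) j * flipOp (m + 1) (j + 1)) := by
    intro j hj
    have hj := List.mem_range.1 hj
    refine eq_neg_of_add_eq_zero_left ?_
    rw [majP_succ_mul_majQ (by omega), flipOp, wop_mul, wop_mul]
    refine wop_add_eq_zero (fun σ => ?_) (fun σ => rfl)
    rw [sgn_flipTo (by omega), sgn_flipTo (by omega), if_pos (by omega), if_neg (by omega)]
    ring
  have hc : ∀ j ∈ List.range m, ∀ i ∈ List.range m, i ≠ j →
      Commute (flipOp (m + 1) (j + 1)) (majP (m + 1) (i + 1) * majQ (m + 1) i) := by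
    intro j hj i hi hij
    have hj := List.mem_range.1 hj
    have hi := List.mem_range.1 hi
    rw [majP_succ_mul_majQ (by omega), flipOp, commute_iff_eq, wop_mul, wop_mul]
    congr 1
    ext σ
    rw [sgn_flipTo (by omega), sgn_flipTo (by omega)]
    split_ifs <;> first | ring1 | omega
  have hanti : ∀ j ∈ List.range m, flipOp (m + 1) (j + 1) * (L * Y) =
      -((L * Y) * flipOp (m + 1) (j + 1)) := by
    intro j hj
    have hj := List.mem_range.1 hj
    have h1 : flipOp (m + 1) (j + 1) * L = -(L * flipOp (m + 1) (j + 1)) := by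
      refine eq_neg_of_add_eq_zero_left ?_
      rw [hL, flipOp, wop_mul, wop_mul]
      refine wop_add_eq_zero (fun σ => ?_) (fun σ => flipTo_comm _ _ _)
      rw [sgn_flipTo (by omega), sgn_flipTo (by omega), if_pos (by omega), if_neg (by omega)]
      ring
    exact mul_anticomm_of_commute h1 (hY _)
  have e1 := trace_mul_prod_of_commute (x := fun j => majP (m + 1) (j + 1) * majQ (m + 1) j)
    (g := fun j => flipOp (m + 1) (j + 1)) (c := c) (s := -s) (R := Y) (l := List.range m)
    List.nodup_range (fun j _ => flipOp_mul_self _) hx hc (fun j _ => hY _)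
  have e2 := trace_mul_prod_of_anticommute (x := fun j => majP (m + 1) (j + 1) * majQ (m + 1) j)
    (g := fun j => flipOp (m + 1) (j + 1)) (c := c) (s := -s) (R := L * Y) (l := List.range m)
    List.nodup_range (fun j _ => flipOp_mul_self _) hx hc hanti
  have e3 : ((List.range m).map fun j => majP (m + 1) (j + 1) * majQ (m + 1) j).prod * L =
      ((-1) ^ (m + 1) * τ) • flipOp (m + 1) (m + 1) := by
    rw [prod_majP_succ_mul_majQ (by omega), hL, wop_mul, flipOp, smul_wop]
    congr 1
    ext σ
    have h1 := sgn_mul_self 0 σ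
    have h2 := sgn_mul_self m σ
    linear_combination ((-1) ^ (m + 1) * τ * (sgn m σ * sgn m σ)) * h1 + ((-1) ^ (m + 1) * τ) * h2
  rw [pairRot_shift_eq, mul_assoc, LinearMap.trace_mul_comm, add_mul, add_mul, map_add,
    smul_mul_assoc, smul_mul_assoc, map_smul, e2, mul_assoc L, LinearMap.trace_mul_comm _ L,
    mul_assoc, mul_assoc Y, e3, ← Algebra.smul_def,
    map_smul, e1, List.length_range, mul_smul_comm, map_smul]
  simp only [smul_eq_mul]
  have : (-s) ^ m = (-1) ^ m * s ^ m := by rw [← mul_pow, neg_one_mul]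
  have h1 : ((-1 : ℂ) ^ m) * (-1) ^ m = 1 := by rw [← mul_pow]; simp
  rw [this]
  linear_combination (s ^ (m + 1) * τ * LinearMap.trace ℂ _ (Y * flipOp (m + 1) (m + 1))) * h1

end SpinOperators

section Spectrum
open Finset

lemma conj_comp {A : Type*} [Ring A] [Algebra ℂ A] {f e u p q : A} {x y x₁ y₁ x₂ y₂ : ℂ}
    (he : e * u = (x • p + y • q) * e) (hp : f * p = (x₁ • p + y₁ • q) * f)
    (hq : f * q = (x₂ • p + y₂ • q) * f) :
    f * e * u = ((x * x₁ + y * x₂) • p + (x * y₁ + y * y₂) • q) * (f * e) := by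
  rw [mul_assoc, he, ← mul_assoc, ← mul_assoc]
  congr 1
  rw [mul_add, mul_smul_comm, mul_smul_comm, hp, hq, ← smul_mul_assoc, ← smul_mul_assoc, ← add_mul]
  congr 1
  module

namespace IsClifford
variable {A : Type*} [Ring A] [Algebra ℂ A] {n : ℕ} {p q : ℕ → A} {τ c s c₀ s₀ z : ℂ}

lemma shiftRot_mul_mode (h : IsClifford n p q) (hn : 0 < n) (hτ : τ * τ = 1) (hz : z ^ n = -τ)
    (hcs : c₀ ^ 2 - s₀ ^ 2 = 1) :
    pairRot n (shiftGen n τ p) q c₀ (-s₀) * mode n p z =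
      ((c₀ ^ 2 + s₀ ^ 2) • mode n p z + (2 * c₀ * s₀ * z) • mode n q z) *
        pairRot n (shiftGen n τ p) q c₀ (-s₀) ∧
    pairRot n (shiftGen n τ p) q c₀ (-s₀) * mode n q z =
      ((2 * c₀ * s₀ * z⁻¹) • mode n p z + (c₀ ^ 2 + s₀ ^ 2) • mode n q z) *
        pairRot n (shiftGen n τ p) q c₀ (-s₀) := by
  have hz0 : z ≠ 0 := by
    rintro rfl
    rw [zero_pow hn.ne', zero_eq_neg] at hz
    simp [hz] at hτ
  have hcs' : c₀ ^ 2 - (-s₀) ^ 2 = 1 := by rw [neg_sq, hcs]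
  have h1 := (h.shift hτ).pairRot_mul_mode_p hcs' z
  have h2 := (h.shift hτ).pairRot_mul_mode_q hcs' z
  have hm : mode n (shiftGen n τ p) z = z⁻¹ • mode n p z := by
    rw [← mode_shiftGen (p := p) hn hτ hz, smul_smul, inv_mul_cancel₀ hz0, one_smul]
  constructor
  · rw [← mode_shiftGen hn hτ hz, mul_smul_comm, h1, ← smul_mul_assoc]
    congr 1
    module
  · rw [h2, hm]
    congr 1
    module

lemma shiftRot_mul_pairRot_mul_mode (h : IsClifford n p q) (hn : 0 < n) (hτ : τ * τ = 1)
    (hz : z ^ n = -τ) (hcs : c ^ 2 - s ^ 2 = 1) (hcs₀ : c₀ ^ 2 - s₀ ^ 2 = 1) :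
    pairRot n (shiftGen n τ p) q c₀ (-s₀) * pairRot n p q c s * mode n p z =
      (((c ^ 2 + s ^ 2) * (c₀ ^ 2 + s₀ ^ 2) - 2 * c * s * (2 * c₀ * s₀) * z⁻¹) • mode n p z +
        ((c ^ 2 + s ^ 2) * (2 * c₀ * s₀) * z - 2 * c * s * (c₀ ^ 2 + s₀ ^ 2)) • mode n q z) *
        (pairRot n (shiftGen n τ p) q c₀ (-s₀) * pairRot n p q c s) ∧
    pairRot n (shiftGen n τ p) q c₀ (-s₀) * pairRot n p q c s * mode n q z =
      (((c ^ 2 + s ^ 2) * (2 * c₀ * s₀) * z⁻¹ - 2 * c * s * (c₀ ^ 2 + s₀ ^ 2)) • mode n p z +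
        ((c ^ 2 + s ^ 2) * (c₀ ^ 2 + s₀ ^ 2) - 2 * c * s * (2 * c₀ * s₀) * z) • mode n q z) *
        (pairRot n (shiftGen n τ p) q c₀ (-s₀) * pairRot n p q c s) := by
  obtain ⟨h1, h2⟩ := h.shiftRot_mul_mode hn hτ hz hcs₀
  constructor
  · rw [conj_comp (h.pairRot_mul_mode_p hcs z) h1 h2]
    congr 1
    module
  · rw [conj_comp (h.pairRot_mul_mode_q hcs z) h1 h2]
    congr 1
    module

end IsClifford

/-- The transfer matrix with the translation twisted by the sign `τ`. -/
noncomputable def twistedTransfer (n : ℕ) (τ : ℂ) (u v : ℝ) :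
    Module.End ℂ ((Fin n → Bool) → ℂ) :=
  pairRot n (IsClifford.shiftGen n τ (majP n)) (majQ n) (Complex.cosh v) (-Complex.sinh v) *
    pairRot n (majP n) (majQ n) (Complex.cosh u) (Complex.sinh u)

lemma mul_mode_anticomm {A : Type*} [Ring A] [Algebra ℂ A] {n : ℕ} {p q : ℕ → A} {P : A}
    (hp : ∀ j < n, P * p j = -(p j * P)) (hq : ∀ j < n, P * q j = -(q j * P)) (x y z z' : ℂ) :
    P * (x • mode n p z + y • mode n q z') = -((x • mode n p z + y • mode n q z') * P) := by
  have h1 {p : ℕ → A} (hp : ∀ j < n, P * p j = -(p j * P)) (z : ℂ) :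
      P * mode n p z = -(mode n p z * P) := by
    rw [mode, mul_sum, sum_mul, ← sum_neg_distrib]
    refine sum_congr rfl fun j hj => ?_
    rw [mul_smul_comm, hp j (mem_range.1 hj), smul_neg, smul_mul_assoc]
  rw [mul_add, mul_smul_comm, mul_smul_comm, h1 hp, h1 hq, add_mul, neg_add, smul_mul_assoc,
    smul_mul_assoc, smul_neg, smul_neg]

/-- The momenta `exp (i π (2 k + σ) / n)`. -/
noncomputable def momentum (n σ : ℕ) (k : Fin n) : ℂ :=
  Complex.exp ((Real.pi * (2 * k + σ : ℕ) / n : ℝ) * Complex.I)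

lemma momentum_pow (n σ : ℕ) (k : Fin n) : momentum n σ k ^ n = (-1) ^ σ := by
  have hn : (n : ℂ) ≠ 0 := by exact_mod_cast k.pos.ne'
  rw [momentum, ← Complex.exp_nat_mul]
  have : (n : ℂ) * ((Real.pi * (2 * k + σ : ℕ) / n : ℝ) * Complex.I) =
      (2 * k + σ : ℕ) * (Real.pi * Complex.I) := by
    push_cast
    field_simp
  rw [this, Complex.exp_nat_mul, Complex.exp_pi_mul_I, pow_add, pow_mul]
  simp

lemma norm_momentum (n σ : ℕ) (k : Fin n) : ‖momentum n σ k‖ = 1 :=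
  Complex.norm_exp_ofReal_mul_I _

lemma momentum_add_inv (n σ : ℕ) (k : Fin n) :
    momentum n σ k + (momentum n σ k)⁻¹ = 2 * (Real.cos (Real.pi * (2 * k + σ : ℕ) / n) : ℝ) := by
  rw [momentum, ← Complex.exp_neg, Complex.ofReal_cos, Complex.two_cos, neg_mul]

lemma momentum_orthogonal (n σ : ℕ) (k l : Fin n) :
    ∑ j ∈ range n, (momentum n σ k * (momentum n σ l)⁻¹) ^ j = if k = l then (n : ℂ) else 0 := by
  have hn : n ≠ 0 := k.pos.ne'
  have hn' : (n : ℂ) ≠ 0 := by exact_mod_cast hn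
  have hl : momentum n σ l ≠ 0 := Complex.exp_ne_zero _
  split_ifs with h
  · subst h
    simp [mul_inv_cancel₀ hl]
  · have h1 : momentum n σ k * (momentum n σ l)⁻¹ ≠ 1 := by
      intro h1
      have h2 := (mul_inv_eq_one₀ hl).1 h1
      have hz (k : Fin n) : momentum n σ k = Complex.exp ((Real.pi * σ / n : ℝ) * Complex.I) *
          Complex.exp (2 * Real.pi * Complex.I / n) ^ (k : ℕ) := by
        rw [momentum, ← Complex.exp_nat_mul, ← Complex.exp_add]
        congr 1
        push_cast
        ring
      rw [hz, hz, mul_right_inj' (Complex.exp_ne_zero _)] at h2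
      exact h (Fin.ext ((Complex.isPrimitiveRoot_exp n hn).pow_inj k.2 l.2 h2))
    have h2 := mul_geom_sum (momentum n σ k * (momentum n σ l)⁻¹) n
    rw [mul_pow, inv_pow, momentum_pow, momentum_pow, mul_inv_cancel₀ (by simp), sub_self] at h2
    exact (mul_eq_zero.1 h2).resolve_left (sub_ne_zero.2 h1)

variable {n σ : ℕ} {u v : ℝ}

lemma cosh_sq_sub_sinh_sq_ofReal (x : ℝ) : Complex.cosh x ^ 2 - Complex.sinh x ^ 2 = 1 :=
  Complex.cosh_sq_sub_sinh_sq _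

lemma exists_isCAR_twistedTransfer (hn : 0 < n) (hv : 0 < v) (huv : v < u)
    (hV : twistedTransfer n (-(-1) ^ σ) u v ≠ 0) {g : Fin n → ℝ} (hg : ∀ k, 0 < g k)
    (hcosh : ∀ k : Fin n, Real.cosh (g k) = Real.cosh (2 * u) * Real.cosh (2 * v) -
      Real.cos (Real.pi * (2 * k + σ : ℕ) / n) * (Real.sinh (2 * u) * Real.sinh (2 * v))) :
    ∃ x y x' y' : Fin n → ℂ,
      IsCAR (fun k => x k • mode n (majP n) (momentum n σ k) +
          y k • mode n (majQ n) (momentum n σ k))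
        (fun k => x' k • mode n (majP n) (momentum n σ k)⁻¹ +
          y' k • mode n (majQ n) (momentum n σ k)⁻¹) ∧
      (∀ k, twistedTransfer n (-(-1) ^ σ) u v * (x k • mode n (majP n) (momentum n σ k) +
          y k • mode n (majQ n) (momentum n σ k)) =
        Complex.exp (-g k) • ((x k • mode n (majP n) (momentum n σ k) +
          y k • mode n (majQ n) (momentum n σ k)) * twistedTransfer n (-(-1) ^ σ) u v)) ∧
      ∀ k, twistedTransfer n (-(-1) ^ σ) u v * (x' k • mode n (majP n) (momentum n σ k)⁻¹ +
          y' k • mode n (majQ n) (momentum n σ k)⁻¹) =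
        (Complex.exp (-g k))⁻¹ • ((x' k • mode n (majP n) (momentum n σ k)⁻¹ +
          y' k • mode n (majQ n) (momentum n σ k)⁻¹) * twistedTransfer n (-(-1) ^ σ) u v) := by
  have hτ : (-(-1 : ℂ) ^ σ) * (-(-1) ^ σ) = 1 := by
    rw [neg_mul_neg, ← mul_pow]; simp
  have hu' := cosh_sq_sub_sinh_sq_ofReal u
  have hv' := cosh_sq_sub_sinh_sq_ofReal v
  have hz (k : Fin n) : momentum n σ k ^ n = - -(-1) ^ σ := by rw [momentum_pow, neg_neg]
  have hz' (k : Fin n) : (momentum n σ k)⁻¹ ^ n = - -(-1) ^ σ := by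
    rw [inv_pow, momentum_pow, neg_neg]
    rcases neg_one_pow_eq_or ℂ σ with h | h <;> simp [h]
  have hz0 (k : Fin n) : momentum n σ k ≠ 0 := Complex.exp_ne_zero _
  have hC (x : ℝ) : Complex.cosh x ^ 2 + Complex.sinh x ^ 2 = (Real.cosh (2 * x) : ℝ) := by
    rw [Complex.ofReal_cosh, Complex.ofReal_mul, Complex.ofReal_ofNat, Complex.cosh_two_mul]
  have hS (x : ℝ) : 2 * Complex.cosh x * Complex.sinh x = (Real.sinh (2 * x) : ℝ) := by
    rw [Complex.ofReal_sinh, Complex.ofReal_mul, Complex.ofReal_ofNat, Complex.sinh_two_mul]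
    ring
  have hpm (k) := (isClifford_maj n).shiftRot_mul_pairRot_mul_mode hn hτ (hz k) hu' hv'
  have hpm' (k) := (isClifford_maj n).shiftRot_mul_pairRot_mul_mode hn hτ (hz' k) hu' hv'
  simp only [hC, hS, inv_inv] at hpm hpm'
  have hlt : Real.cosh (2 * u) * Real.sinh (2 * v) < Real.sinh (2 * u) * Real.cosh (2 * v) := by
    have h1 : 0 < Real.sinh (2 * u - 2 * v) := Real.sinh_pos_iff.2 (by linarith)
    rw [Real.sinh_sub] at h1
    linarith
  have hpos : 0 < Real.cosh (2 * u) * Real.sinh (2 * v) :=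
    mul_pos (Real.cosh_pos _) (Real.sinh_pos_iff.2 (by linarith))
  have hne {y : ℂ} (hy : ‖y‖ = 1) : (Real.cosh (2 * u) * Real.sinh (2 * v) * y : ℂ) -
      Real.sinh (2 * u) * Real.cosh (2 * v) ≠ 0 := by
    intro h
    have h1 := congrArg norm (sub_eq_zero.1 h)
    rw [norm_mul, hy, mul_one, ← Complex.ofReal_mul, ← Complex.ofReal_mul, Complex.norm_real,
      Complex.norm_real, Real.norm_of_nonneg hpos.le, Real.norm_of_nonneg (hpos.trans hlt).le] at h1
    exact hlt.ne h1
  have hcu : ((Real.cosh (2 * u) : ℝ) : ℂ) ^ 2 - ((Real.sinh (2 * u) : ℝ) : ℂ) ^ 2 = 1 := by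
    exact_mod_cast Real.cosh_sq_sub_sinh_sq _
  have hcv : ((Real.cosh (2 * v) : ℝ) : ℂ) ^ 2 - ((Real.sinh (2 * v) : ℝ) : ℂ) ^ 2 = 1 := by
    exact_mod_cast Real.cosh_sq_sub_sinh_sq _
  refine (isClifford_maj n).exists_isCAR hV (momentum_orthogonal n σ) (fun k => (hpm k).1)
    (fun k => (hpm k).2) (fun k => (hpm' k).1) (fun k => (hpm' k).2) (fun k => ?_) (fun k => ?_)
    (fun k => Complex.exp_ne_zero _) (fun k l => ?_) (fun k => hne (norm_momentum n σ k))
    (fun k => hne (by rw [norm_inv, norm_momentum, inv_one]))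
  · have := mul_inv_cancel₀ (hz0 k)
    generalize ((Real.cosh (2 * u) : ℝ) : ℂ) = c at *
    generalize ((Real.sinh (2 * u) : ℝ) : ℂ) = s at *
    generalize ((Real.cosh (2 * v) : ℝ) : ℂ) = c' at *
    generalize ((Real.sinh (2 * v) : ℝ) : ℂ) = s' at *
    linear_combination (s ^ 2 * s' ^ 2 - c ^ 2 * s' ^ 2) * this + (c ^ 2 - s ^ 2) * hcv + hcu
  · have h1 := momentum_add_inv n σ k
    have h2 : (2 : ℂ) * (Real.cosh (g k) : ℝ) = Complex.exp (-g k) + (Complex.exp (-g k))⁻¹ := by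
      rw [← Complex.exp_neg, neg_neg, Complex.ofReal_cosh, Complex.two_cosh, add_comm]
    rw [← h2, hcosh]
    push_cast at h1 ⊢
    linear_combination (-(Complex.sinh (2 * u) * Complex.sinh (2 * v))) * h1
  · rw [← Complex.exp_add]
    intro h
    have h1 := congrArg norm h
    rw [← Complex.ofReal_neg, ← Complex.ofReal_neg, ← Complex.ofReal_add, Complex.norm_exp_ofReal,
      norm_one, Real.exp_eq_one_iff] at h1
    linarith [hg k, hg l]

end Spectrum

section SpectrumTrace
open Finset
variable {n σ : ℕ} {u v : ℝ}

lemma trace_twistedTransfer (hn : 0 < n) (τ : ℂ) (u v : ℝ) :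
    LinearMap.trace ℂ _ (twistedTransfer n τ u v) =
      2 ^ n * (Complex.cosh u ^ n * Complex.cosh v ^ n +
        τ * (Complex.sinh u ^ n * Complex.sinh v ^ n)) ∧
    LinearMap.trace ℂ _ (twistedTransfer n τ u v * flipOp n n) =
      2 ^ n * (Complex.sinh u ^ n * Complex.cosh v ^ n +
        τ * (Complex.cosh u ^ n * Complex.sinh v ^ n)) ∧
    LinearMap.trace ℂ _ (pairRot n (majP n) (majQ n) (Complex.cosh u) (-Complex.sinh u) *
      pairRot n (IsClifford.shiftGen n τ (majP n)) (majQ n) (Complex.cosh v) (Complex.sinh v)) =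
      2 ^ n * (Complex.cosh u ^ n * Complex.cosh v ^ n +
        τ * (Complex.sinh u ^ n * Complex.sinh v ^ n)) := by
  have hc (k : ℕ) : Commute (flipOp n k) (flipOp n n) := by
    rw [commute_iff_eq, flipOp, flipOp, wop_mul, wop_mul]
    congr 1
    exact funext fun σ => flipTo_comm _ _ _
  refine ⟨?_, ?_, ?_⟩
  · rw [twistedTransfer, trace_pairRot_shift_mul hn _ _ _ fun k => commute_flipOp_pairRot k _ _,
      trace_pairRot, trace_pairRot_mul_parity]
    ring
  · rw [twistedTransfer, mul_assoc, trace_pairRot_shift_mul hn _ _ _ fun k =>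
      (commute_flipOp_pairRot k _ _).mul_right (hc k), mul_assoc (pairRot _ _ _ _ _),
      flipOp_mul_self, mul_one, trace_pairRot, trace_pairRot_mul_parity]
    ring
  · rw [LinearMap.trace_mul_comm, ← neg_neg (Complex.sinh v), trace_pairRot_shift_mul hn _ _ _
      fun k => commute_flipOp_pairRot k _ _, trace_pairRot, trace_pairRot_mul_parity, neg_neg]
    have : (-Complex.sinh u) ^ n * (-Complex.sinh v) ^ n =
        Complex.sinh u ^ n * Complex.sinh v ^ n := by
      rw [← mul_pow, neg_mul_neg, mul_pow]
    linear_combination (2 ^ n * τ) * this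

lemma twistedTransfer_mul_inv {τ : ℂ} (hτ : τ * τ = 1) (u v : ℝ) :
    twistedTransfer n τ u v * (pairRot n (majP n) (majQ n) (Complex.cosh u) (-Complex.sinh u) *
      pairRot n (IsClifford.shiftGen n τ (majP n)) (majQ n) (Complex.cosh v) (Complex.sinh v)) =
        1 := by
  have h1 := (isClifford_maj n).pairRot_mul_pairRot_neg (cosh_sq_sub_sinh_sq_ofReal u)
  have h2 := ((isClifford_maj n).shift hτ).pairRot_mul_pairRot_neg (c := Complex.cosh v)
    (s := -Complex.sinh v) (by rw [neg_sq, cosh_sq_sub_sinh_sq_ofReal])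
  rw [neg_neg] at h2
  rw [twistedTransfer, mul_assoc, ← mul_assoc (pairRot n (majP n) (majQ n) _ _), h1, one_mul, h2]

/-- The vacuum eigenvalue and its parity are determined by the signs of a few traces. -/
lemma vacuum_eigenvalue {ι : Type*} [Fintype ι] {g : ι → ℝ} (hg : ∀ k, 0 < g k) {C ε : ℂ}
    {t t' : ℝ} (ht : 0 < t) (ht' : 0 < t') (hε : ε * ε = 1)
    (hinv : (t : ℂ) = C⁻¹ * ∏ k, (1 + (Complex.exp (-g k))⁻¹))
    (htr : (t : ℂ) = C * ∏ k, (1 + Complex.exp (-g k)))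
    (htr' : (t' : ℂ) = ε * C * ∏ k, (1 - Complex.exp (-g k))) :
    C = Real.exp ((∑ k, g k) / 2) ∧ ε = 1 := by
  set A : ℝ := ∏ k, (1 + Real.exp (-g k)) with hA
  set B : ℝ := ∏ k, (1 - Real.exp (-g k)) with hB
  have hA' : (A : ℂ) = ∏ k, (1 + Complex.exp (-g k)) := by rw [hA]; push_cast; rfl
  have hB' : (B : ℂ) = ∏ k, (1 - Complex.exp (-g k)) := by rw [hB]; push_cast; rfl
  have hA0 : 0 < A := prod_pos fun k _ => by positivity
  have hB0 : 0 < B := prod_pos fun k _ => by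
    have := Real.exp_lt_one_iff.2 (neg_lt_zero.2 (hg k))
    linarith
  have hD : ∏ k, (1 + (Complex.exp (-g k))⁻¹) = ((Real.exp (∑ k, g k) * A : ℝ) : ℂ) := by
    rw [Real.exp_sum, hA, ← prod_mul_distrib]
    push_cast
    refine prod_congr rfl fun k _ => ?_
    rw [← Complex.exp_neg, neg_neg, mul_add, ← Complex.exp_add, add_neg_cancel, Complex.exp_zero,
      mul_one, add_comm]
  rw [← hA'] at htr
  rw [hD] at hinv
  rw [← hB'] at htr'
  have hC : C = ((t / A : ℝ) : ℂ) := by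
    rw [Complex.ofReal_div, htr, mul_div_cancel_right₀]
    exact_mod_cast hA0.ne'
  have hC0 : 0 < t / A := div_pos ht hA0
  rw [hC] at hinv htr'
  have h1 : t / A = Real.exp ((∑ k, g k) / 2) := by
    have h2 : t = (t / A)⁻¹ * (Real.exp (∑ k, g k) * A) := by exact_mod_cast hinv
    have h3 : (t / A) ^ 2 = Real.exp ((∑ k, g k) / 2) ^ 2 := by
      rw [← Real.exp_nat_mul]
      have : ((2 : ℕ) : ℝ) * ((∑ k, g k) / 2) = ∑ k, g k := by push_cast; ring
      rw [this]
      field_simp at h2 ⊢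
      linear_combination h2
    exact (pow_left_inj₀ hC0.le (Real.exp_pos _).le two_ne_zero).1 h3
  refine ⟨by rw [hC, h1], ?_⟩
  rcases mul_self_eq_one_iff.1 hε with h | h
  · exact h
  · rw [h] at htr'
    have h2 : t' = -1 * (t / A) * B := by exact_mod_cast htr'
    have := mul_pos hC0 hB0
    linarith

theorem trace_twistedTransfer_pow (hn : 0 < n) (hv : 0 < v) (huv : v < u)
    {g : Fin n → ℝ} (hg : ∀ k, 0 < g k)
    (hcosh : ∀ k : Fin n, Real.cosh (g k) = Real.cosh (2 * u) * Real.cosh (2 * v) -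
      Real.cos (Real.pi * (2 * k + σ : ℕ) / n) * (Real.sinh (2 * u) * Real.sinh (2 * v))) (m : ℕ) :
    LinearMap.trace ℂ _ (twistedTransfer n (-(-1) ^ σ) u v ^ m) =
      ((Real.exp ((∑ k, g k) / 2) ^ m * ∏ k, (1 + Real.exp (-g k) ^ m) : ℝ) : ℂ) ∧
    LinearMap.trace ℂ _ (twistedTransfer n (-(-1) ^ σ) u v ^ m * flipOp n n) =
      ((Real.exp ((∑ k, g k) / 2) ^ m * ∏ k, (1 - Real.exp (-g k) ^ m) : ℝ) : ℂ) := by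
  have hτ : (-(-1 : ℂ) ^ σ) * (-(-1) ^ σ) = 1 := by
    rw [neg_mul_neg, ← mul_pow]; simp
  have hVV' := twistedTransfer_mul_inv (n := n) hτ u v
  obtain ⟨h1, h2, h3⟩ := trace_twistedTransfer hn (-(-1) ^ σ) u v
  set V' := pairRot n (majP n) (majQ n) (Complex.cosh u) (-Complex.sinh u) *
      pairRot n (IsClifford.shiftGen n (-(-1) ^ σ) (majP n)) (majQ n) (Complex.cosh v)
        (Complex.sinh v) with hV'
  set V := twistedTransfer n (-(-1) ^ σ) u v with hV
  have hV'V : V' * V = 1 := mul_eq_one_comm.1 hVV'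
  have hsv : 0 < Real.sinh v := Real.sinh_pos_iff.2 hv
  have hsu : 0 < Real.sinh u := Real.sinh_pos_iff.2 (hv.trans huv)
  have hcu := Real.cosh_pos u
  have hcv := Real.cosh_pos v
  have hlt : Real.cosh u * Real.sinh v < Real.sinh u * Real.cosh v := by
    have h1 : 0 < Real.sinh (u - v) := Real.sinh_pos_iff.2 (by linarith)
    rw [Real.sinh_sub] at h1
    linarith
  have hlt' : Real.sinh u * Real.sinh v < Real.cosh u * Real.cosh v :=
    mul_lt_mul'' (Real.sinh_lt_cosh u) (Real.sinh_lt_cosh v) hsu.le hsv.le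
  have hltn : (Real.cosh u * Real.sinh v) ^ n < (Real.sinh u * Real.cosh v) ^ n :=
    pow_lt_pow_left₀ hlt (by positivity) hn.ne'
  have hltn' : (Real.sinh u * Real.sinh v) ^ n < (Real.cosh u * Real.cosh v) ^ n :=
    pow_lt_pow_left₀ hlt' (by positivity) hn.ne'
  have hp1 : 0 < (Real.cosh u * Real.sinh v) ^ n := by positivity
  have hp2 : 0 < (Real.sinh u * Real.sinh v) ^ n := by positivity
  rw [mul_pow, mul_pow] at hltn hltn'
  rw [mul_pow] at hp1 hp2
  set t : ℝ := 2 ^ n * (Real.cosh u ^ n * Real.cosh v ^ n +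
    -(-1) ^ σ * (Real.sinh u ^ n * Real.sinh v ^ n)) with ht
  set t' : ℝ := 2 ^ n * (Real.sinh u ^ n * Real.cosh v ^ n +
    -(-1) ^ σ * (Real.cosh u ^ n * Real.sinh v ^ n)) with ht'
  have ht0 : 0 < t := by
    refine mul_pos (by positivity) ?_
    rcases neg_one_pow_eq_or ℝ σ with h | h <;> rw [h] <;> linarith
  have ht0' : 0 < t' := by
    refine mul_pos (by positivity) ?_
    rcases neg_one_pow_eq_or ℝ σ with h | h <;> rw [h] <;> linarith
  have e1 : (t : ℂ) = LinearMap.trace ℂ _ V := by rw [h1, ht]; push_cast; rfl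
  have e2 : (t' : ℂ) = LinearMap.trace ℂ _ (V * flipOp n n) := by rw [h2, ht']; push_cast; rfl
  have e3 : (t : ℂ) = LinearMap.trace ℂ _ V' := by rw [h3, ht]; push_cast; rfl
  have hV0 : V ≠ 0 := by
    intro h
    rw [h, map_zero] at e1
    exact ht0.ne' (by exact_mod_cast e1)
  obtain ⟨x, y, x', y', hcar, hη, hξ⟩ := exists_isCAR_twistedTransfer hn hv huv hV0 hg hcosh
  have hP := mul_mode_anticomm (P := flipOp n n) (fun j hj => parity_mul_majP hj)
    (fun j hj => parity_mul_majQ hj)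
  obtain ⟨C, ε, hε, -, i1, i2, i3⟩ := hcar.exists_trace_pow
    (by rw [trace_one_spin, Fintype.card_fin]) hV'V hVV' (fun k => Complex.exp_ne_zero _) hη hξ
    (flipOp_mul_self n) (fun k => hP _ _ _ _) (fun k => hP _ _ _ _)
  have j2 := i2 1
  have j3 := i3 1
  simp only [pow_one] at j2 j3
  rw [← e1] at j2
  rw [← e2] at j3
  rw [← e3] at i1
  obtain ⟨hC, hε1⟩ := vacuum_eigenvalue hg ht0 ht0' hε i1 j2 j3
  rw [i2, i3, hC, hε1]
  push_cast
  exact ⟨rfl, by rw [one_mul]⟩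

end SpectrumTrace

section TransferMatrix
open Finset

lemma sum_path_eq_trace {S R : Type*} [Fintype S] [DecidableEq S] [CommRing R] (M N : Matrix S S R)
    (m : ℕ) :
    ∑ σ : Fin (m + 1) → S, (∏ i : Fin m, M (σ i.castSucc) (σ i.succ)) * N (σ (Fin.last m)) (σ 0) =
      (M ^ m * N).trace := by
  induction m generalizing N with
  | zero =>
    rw [← (Equiv.funUnique (Fin 1) S).symm.sum_comp]
    simp [Matrix.trace]
  | succ m ih =>
    rw [pow_succ', mul_assoc, Matrix.trace_mul_comm, mul_assoc, ← ih,
      ← (Fin.consEquiv fun _ => S).sum_comp, Fintype.sum_prod_type, sum_comm]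
    refine sum_congr rfl fun σ _ => ?_
    rw [Matrix.mul_apply, mul_sum]
    refine sum_congr rfl fun x _ => ?_
    rw [Fin.prod_univ_succ]
    simp only [Fin.consEquiv_apply, Fin.cons_succ, Fin.castSucc_zero, Fin.cons_zero,
      ← Fin.succ_castSucc, ← Fin.succ_last]
    ring

variable {n : ℕ}

/-- The Boltzmann weights between neighbouring columns. -/
noncomputable def columnWeight (n : ℕ) (a b : ℝ) : Matrix (Fin n → Bool) (Fin n → Bool) ℂ :=
  Matrix.of fun σ τ => ((Real.exp (∑ j, (a * spinv (σ j) * spinv (τ j) +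
    b * spinv (σ j) * spinv (σ (cyc j 1)))) : ℝ) : ℂ)

lemma cyc_castSucc {m : ℕ} (i : Fin m) : cyc i.castSucc 1 = i.succ := by
  ext
  simp [cyc, Nat.mod_eq_of_lt]

lemma cyc_last (m : ℕ) : cyc (Fin.last m) 1 = 0 := by
  ext
  simp [cyc]

lemma twistedSum_eq_trace (m n : ℕ) (a a' b : ℝ) :
    ((∑ σ : Fin (m + 1) × Fin n → Bool, ((2 : ℝ)⁻¹) ^ ((m + 1) * n) *
      Real.exp (∑ x : Fin (m + 1) × Fin n,
        ((if x.1.val + 1 = m + 1 then a' else a) * spinv (σ x) * spinv (σ (cyc x.1 1, x.2)) +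
          b * spinv (σ x) * spinv (σ (x.1, cyc x.2 1)))) : ℝ) : ℂ) =
      (2⁻¹) ^ ((m + 1) * n) * (columnWeight n a b ^ m * columnWeight n a' b).trace := by
  rw [← sum_path_eq_trace, mul_sum, Complex.ofReal_sum]
  refine Fintype.sum_equiv (Equiv.curry _ _ _) _ _ fun σ => ?_
  rw [Complex.ofReal_mul]
  congr 1
  · simp
  · rw [Fintype.sum_prod_type, Real.exp_sum, Fin.prod_univ_castSucc, Complex.ofReal_mul,
      Complex.ofReal_prod]
    congr 1
    · refine prod_congr rfl fun i _ => ?_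
      have : ¬ (i.castSucc.val + 1 = m + 1) := by have := i.2; simp; omega
      simp only [if_neg this, cyc_castSucc]
      rfl
    · simp only [Fin.val_last, cyc_last]
      rfl

lemma ZI_eq_trace (m n : ℕ) (a b : ℝ) :
    (ZI (m + 1) n a b : ℂ) = (2⁻¹) ^ ((m + 1) * n) * (columnWeight n a b ^ (m + 1)).trace := by
  rw [pow_succ (columnWeight n a b), ← twistedSum_eq_trace]
  simp [ZI]

lemma ZIm_eq_trace (m n : ℕ) (a b : ℝ) :
    (ZIm (m + 1) n a b : ℂ) =
      (2⁻¹) ^ ((m + 1) * n) * (columnWeight n a b ^ m * columnWeight n (-a) b).trace :=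
  twistedSum_eq_trace m n a (-a) b

/-- The operator of multiplication by the Boltzmann weight of a column. -/
noncomputable def columnOp (n : ℕ) (b : ℝ) : Module.End ℂ ((Fin n → Bool) → ℂ) :=
  wop (fun σ => ((Real.exp (∑ j, b * spinv (σ j) * spinv (σ (cyc j 1))) : ℝ) : ℂ)) fun σ => σ

lemma spinv_not (s : Bool) : spinv (!s) = -spinv s := by cases s <;> simp [spinv]

lemma flipTo_succ_flipTo (j : Fin n) (σ : Fin n → Bool) :
    flipTo (j + 1) (flipTo j σ) = Function.update σ j (!σ j) := by
  ext i
  by_cases h : i = j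
  · subst h; simp [flipTo]
  · rw [Function.update_of_ne h]
    have : i.val ≠ j.val := fun e => h (Fin.ext e)
    unfold flipTo
    split_ifs <;> first | rfl | omega | simp

/-- Partial products of the transfer matrix between columns. -/
noncomputable def partialWeight (n k : ℕ) (a : ℝ) (σ τ : Fin n → Bool) : ℂ :=
  ∏ j, if j.val < k then ((Real.exp (a * spinv (σ j) * spinv (τ j)) : ℝ) : ℂ) else
    if σ j = τ j then 1 else 0

lemma partialWeight_succ (k : Fin n) (a : ℝ) (σ τ : Fin n → Bool) :
    partialWeight n (k + 1) a σ τ = Real.exp a * partialWeight n k a σ τ +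
      Real.exp (-a) * partialWeight n k a σ (Function.update τ k (!τ k)) := by
  unfold partialWeight
  rw [← mul_prod_erase univ _ (mem_univ k), ← mul_prod_erase univ _ (mem_univ k),
    ← mul_prod_erase univ _ (mem_univ k), if_pos (lt_add_one _),
    if_neg (lt_irrefl _), if_neg (lt_irrefl _)]
  have h1 : ∏ x ∈ univ.erase k, (if x.val < k.val + 1 then
      ((Real.exp (a * spinv (σ x) * spinv (τ x)) : ℝ) : ℂ) else if σ x = τ x then 1 else 0) =
      ∏ x ∈ univ.erase k, (if x.val < k.val then
      ((Real.exp (a * spinv (σ x) * spinv (τ x)) : ℝ) : ℂ) else if σ x = τ x then 1 else 0) := by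
    refine prod_congr rfl fun x hx => ?_
    have : x.val ≠ k.val := fun e => (ne_of_mem_erase hx) (Fin.ext e)
    simp only [show x.val < k.val + 1 ↔ x.val < k.val by omega]
  have h2 : ∏ x ∈ univ.erase k, (if x.val < k.val then
      ((Real.exp (a * spinv (σ x) * spinv (Function.update τ k (!τ k) x)) : ℝ) : ℂ) else
        if σ x = Function.update τ k (!τ k) x then 1 else 0) =
      ∏ x ∈ univ.erase k, (if x.val < k.val then
      ((Real.exp (a * spinv (σ x) * spinv (τ x)) : ℝ) : ℂ) else if σ x = τ x then 1 else 0) :=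
    prod_congr rfl fun x hx => by rw [Function.update_of_ne (ne_of_mem_erase hx)]
  rw [h1, h2, ← mul_assoc, ← mul_assoc, ← add_mul, Function.update_self]
  congr 1
  cases σ k <;> cases τ k <;> simp [spinv]

lemma prod_pair_apply {a u : ℝ} {κ : ℂ} (hc : κ * Complex.cosh u = Real.exp a)
    (hs : κ * Complex.sinh u = Real.exp (-a)) {k : ℕ} (hk : k ≤ n) (f : (Fin n → Bool) → ℂ)
    (σ : Fin n → Bool) :
    κ ^ k * ((List.range k).map fun j => algebraMap ℂ (Module.End ℂ ((Fin n → Bool) → ℂ))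
      (Complex.cosh u) + Complex.sinh u • (majP n j * majQ n j)).prod f σ =
      ∑ τ, partialWeight n k a σ τ * f τ := by
  induction k generalizing f σ with
  | zero =>
    rw [sum_eq_single σ]
    · simp [partialWeight]
    · intro τ _ hτ
      obtain ⟨j, hj⟩ := Function.ne_iff.1 hτ
      rw [partialWeight, prod_eq_zero (mem_univ j), zero_mul]
      simp [hj.symm]
    · simp
  | succ k ih =>
    have hk' : k < n := hk
    rw [List.range_succ, List.map_append, List.prod_append, Module.End.mul_apply, pow_succ',
      mul_assoc, ih hk'.le]
    have h1 (τ : Fin n → Bool) : κ * ((List.map (fun j => algebraMap ℂ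
        (Module.End ℂ ((Fin n → Bool) → ℂ)) (Complex.cosh u) +
          Complex.sinh u • (majP n j * majQ n j)) [k]).prod f τ) =
        Real.exp a * f τ + Real.exp (-a) * f (Function.update τ ⟨k, hk'⟩ (!τ ⟨k, hk'⟩)) := by
      rw [← hc, ← hs, ← flipTo_succ_flipTo ⟨k, hk'⟩]
      simp only [List.map_cons, List.map_nil, List.prod_cons, List.prod_nil, mul_one]
      rw [majP_mul_majQ hk', LinearMap.add_apply, LinearMap.smul_apply, Pi.add_apply, Pi.smul_apply,
        wop_apply, Module.algebraMap_end_apply, Pi.smul_apply]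
      simp only [smul_eq_mul]
      ring
    have h2 : Function.Involutive fun τ : Fin n → Bool =>
        Function.update τ ⟨k, hk'⟩ (!τ ⟨k, hk'⟩) := fun τ => by
      simp
    rw [mul_sum]
    have h3 (τ : Fin n → Bool) : κ * (partialWeight n k a σ τ * ((List.map (fun j => algebraMap ℂ
        (Module.End ℂ ((Fin n → Bool) → ℂ)) (Complex.cosh u) +
          Complex.sinh u • (majP n j * majQ n j)) [k]).prod f τ)) =
        Real.exp a * partialWeight n k a σ τ * f τ + Real.exp (-a) * (partialWeight n k a σ τ *
          f (Function.update τ ⟨k, hk'⟩ (!τ ⟨k, hk'⟩))) := by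
      linear_combination partialWeight n k a σ τ * h1 τ
    simp only [h3]
    rw [sum_add_distrib, ← mul_sum _ _ (Real.exp (-a) : ℂ),
      ← (Equiv.sum_comp h2.toPerm fun τ => partialWeight n k a σ τ *
          f (Function.update τ ⟨k, hk'⟩ (!τ ⟨k, hk'⟩))), mul_sum, ← sum_add_distrib]
    refine sum_congr rfl fun τ _ => ?_
    have h4 : f (Function.update (Function.Involutive.toPerm _ h2 τ) ⟨k, hk'⟩
        (!(Function.Involutive.toPerm _ h2 τ) ⟨k, hk'⟩)) = f τ :=
      by simp [Function.Involutive.coe_toPerm]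
    rw [h4, partialWeight_succ ⟨k, hk'⟩]
    simp only [Function.Involutive.coe_toPerm]
    ring

lemma toLin_columnWeight {a u : ℝ} {κ : ℂ} (hc : κ * Complex.cosh u = Real.exp a)
    (hs : κ * Complex.sinh u = Real.exp (-a)) (b : ℝ) :
    Matrix.toLin' (columnWeight n a b) = κ ^ n • (columnOp n b *
      pairRot n (majP n) (majQ n) (Complex.cosh u) (Complex.sinh u)) := by
  refine LinearMap.ext fun f => funext fun σ => ?_
  rw [LinearMap.smul_apply, Pi.smul_apply, Module.End.mul_apply, columnOp, wop_apply, smul_eq_mul,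
    mul_left_comm, pairRot, prod_pair_apply hc hs le_rfl, mul_sum, Matrix.toLin'_apply,
    Matrix.mulVec, dotProduct]
  refine sum_congr rfl fun τ _ => ?_
  rw [← mul_assoc]
  congr 1
  rw [columnWeight, Matrix.of_apply, sum_add_distrib, Real.exp_add, mul_comm, Complex.ofReal_mul]
  congr 1
  rw [partialWeight, Real.exp_sum, Complex.ofReal_prod]
  exact prod_congr rfl fun j _ => by rw [if_pos j.2]

lemma toLin_columnWeight_neg (a b : ℝ) :
    Matrix.toLin' (columnWeight n (-a) b) = Matrix.toLin' (columnWeight n a b) * flipOp n n := by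
  refine LinearMap.ext fun f => funext fun σ => ?_
  have h : Function.Involutive (flipTo (n := n) n) := flipTo_flipTo n
  rw [Module.End.mul_apply, Matrix.toLin'_apply, Matrix.toLin'_apply, Matrix.mulVec, Matrix.mulVec,
    dotProduct, dotProduct, ← Equiv.sum_comp h.toPerm]
  refine sum_congr rfl fun τ _ => ?_
  rw [flipOp, wop_apply, one_mul]
  congr 1
  simp only [columnWeight, Matrix.of_apply, Function.Involutive.coe_toPerm, flipTo, Fin.is_lt,
    if_true, spinv_not, neg_mul, mul_neg, neg_neg]

end TransferMatrix

section TwistedSectors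
open Finset
variable {n : ℕ}

lemma algebraMap_add_smul_wop (c s : ℂ) (d : (Fin n → Bool) → ℂ) :
    algebraMap ℂ (Module.End ℂ ((Fin n → Bool) → ℂ)) c + s • wop d (fun σ => σ) =
      wop (fun σ => c + s * d σ) fun σ => σ := by
  refine LinearMap.ext fun f => funext fun σ => ?_
  simp only [LinearMap.add_apply, LinearMap.smul_apply, Pi.add_apply, Pi.smul_apply, wop_apply,
    Module.algebraMap_end_apply, smul_eq_mul]
  ring

lemma prod_shiftPair {k : ℕ} (hk : k < n) (c s : ℂ) :
    ((List.range k).map fun j => algebraMap ℂ (Module.End ℂ ((Fin n → Bool) → ℂ)) c +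
      (-s) • (majP n (j + 1) * majQ n j)).prod =
      wop (fun σ => ∏ j ∈ range k, (c + s * (sgn j σ * sgn (j + 1) σ))) fun σ => σ := by
  induction k with
  | zero => simp [wop_one]
  | succ k ih =>
    rw [List.range_succ, List.map_append, List.prod_append, ih (by omega)]
    simp only [List.map_cons, List.map_nil, List.prod_cons, List.prod_nil, mul_one]
    rw [majP_succ_mul_majQ hk, algebraMap_add_smul_wop, wop_mul]
    congr 1
    ext σ
    rw [prod_range_succ, neg_mul_neg]

lemma exp_mul_spinv (b : ℝ) (i j : Fin n) (σ : Fin n → Bool) :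
    ((Real.exp (b * spinv (σ i) * spinv (σ j)) : ℝ) : ℂ) =
      Complex.cosh b + Complex.sinh b * (sgn i σ * sgn j σ) := by
  have h (i : Fin n) : sgn i σ = (spinv (σ i) : ℝ) := by simp [sgn]
  rw [h, h]
  cases σ i <;> cases σ j <;> simp [spinv, Complex.cosh_add_sinh, ← sub_eq_add_neg,
    Complex.cosh_sub_sinh]

lemma columnOp_eq (m : ℕ) (b : ℝ) :
    columnOp (m + 1) b =
      wop (fun σ => ∏ j ∈ range m, (Complex.cosh b + Complex.sinh b * (sgn j σ * sgn (j + 1) σ)))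
        (fun σ => σ) *
      wop (fun σ => Complex.cosh b + Complex.sinh b * (sgn 0 σ * sgn m σ)) (fun σ => σ) := by
  rw [columnOp, wop_mul]
  congr 1
  ext σ
  rw [Real.exp_sum, Complex.ofReal_prod, Fin.prod_univ_castSucc, ← Fin.prod_univ_eq_prod_range
    fun j => Complex.cosh b + Complex.sinh b * (sgn j σ * sgn (j + 1) σ)]
  simp only [exp_mul_spinv, cyc_castSucc, cyc_last]
  simp [mul_comm (sgn m σ)]

lemma shiftRot_mul_parity (hn : 0 < n) {τ : ℂ} (hτ : τ * τ = 1) (b : ℝ) :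
    pairRot n (IsClifford.shiftGen n τ (majP n)) (majQ n) (Complex.cosh b) (-Complex.sinh b) *
      (1 + τ • flipOp n n) = columnOp n b * (1 + τ • flipOp n n) := by
  obtain ⟨m, rfl⟩ : ∃ m, n = m + 1 := ⟨n - 1, by omega⟩
  rw [pairRot_shift_eq, prod_shiftPair (by omega), columnOp_eq, mul_assoc, mul_assoc]
  congr 1
  rw [← algebraMap_add_smul_wop]
  set X : Module.End ℂ ((Fin (m + 1) → Bool) → ℂ) :=
    wop (fun σ => sgn 0 σ * sgn m σ) (fun σ => σ) with hX
  have h : wop (fun σ => -τ * (sgn 0 σ * sgn m σ)) (flipTo (m + 1)) =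
      (-τ) • (X * flipOp (m + 1) (m + 1)) := by
    rw [hX, flipOp, wop_mul, smul_wop]
    simp
  have h2 := flipOp_mul_self (n := m + 1) (m + 1)
  rw [h, add_mul, add_mul]
  congr 1
  rw [smul_mul_assoc, smul_mul_assoc, smul_mul_assoc, mul_add, mul_one, mul_smul_comm, mul_assoc,
    h2, mul_add, mul_one, mul_smul_comm, smul_add, smul_add, smul_add, smul_smul, smul_smul,
    smul_smul, smul_smul, add_comm (_ • (X * _))]
  congr 1
  · congr 1
    linear_combination Complex.sinh b * hτ
  · congr 1
    ring

lemma commute_columnOp (b : ℝ) : Commute (flipOp n n) (columnOp n b) := by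
  rw [commute_iff_eq, flipOp, columnOp, wop_mul, wop_mul]
  congr 1
  ext σ
  rw [one_mul, mul_one]
  simp [flipTo, spinv_not]

lemma pow_mul_eq_of_mul_eq {M : Type*} [Monoid M] {f d e x : M} (h : f * x = d * x)
    (hd : Commute d x) (he : Commute e x) (m : ℕ) : (f * e) ^ m * x = (d * e) ^ m * x := by
  induction m with
  | zero => simp
  | succ m ih =>
    have h1 : Commute ((d * e) ^ m) x := (hd.mul_left he).pow_left m
    rw [pow_succ', mul_assoc, ih, h1.eq, ← mul_assoc, mul_assoc f, he.eq, ← mul_assoc f, h, hd.eq,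
      mul_assoc x, mul_assoc x, ← pow_succ']
    exact ((hd.mul_left he).pow_left (m + 1)).symm.eq

/-- The column-to-column transfer operator, normalised. -/
noncomputable def transferOp (n : ℕ) (u v : ℝ) : Module.End ℂ ((Fin n → Bool) → ℂ) :=
  columnOp n v * pairRot n (majP n) (majQ n) (Complex.cosh u) (Complex.sinh u)

lemma trace_transferOp_pow (hn : 0 < n) {τ : ℂ} (hτ : τ * τ = 1) (u v : ℝ) (m : ℕ) :
    LinearMap.trace ℂ _ (transferOp n u v ^ m) +
      τ * LinearMap.trace ℂ _ (transferOp n u v ^ m * flipOp n n) =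
    LinearMap.trace ℂ _ (twistedTransfer n τ u v ^ m) +
      τ * LinearMap.trace ℂ _ (twistedTransfer n τ u v ^ m * flipOp n n) := by
  have hc (x : Module.End ℂ ((Fin n → Bool) → ℂ)) (hx : Commute (flipOp n n) x) :
      Commute x (1 + τ • flipOp n n) := (Commute.one_right x).add_right (hx.symm.smul_right τ)
  have := congrArg (LinearMap.trace ℂ _) (pow_mul_eq_of_mul_eq (shiftRot_mul_parity hn hτ v)
    (hc _ (commute_columnOp v)) (hc _ (commute_flipOp_pairRot n (Complex.cosh u) (Complex.sinh u)))
    m)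
  rw [mul_add, mul_add, mul_one, mul_one, mul_smul_comm, mul_smul_comm, map_add, map_add, map_smul,
    map_smul] at this
  exact this.symm

/-- The contribution of the sector of twist `σ` to the partition function. -/
noncomputable def sectorTrace {n : ℕ} (σ : ℕ) (g : Fin n → ℝ) (m : ℕ) : ℝ :=
  Real.exp ((∑ k, g k) / 2) ^ m *
    (∏ k, (1 + Real.exp (-g k) ^ m) - (-1) ^ σ * ∏ k, (1 - Real.exp (-g k) ^ m))

theorem one_sub_ZIm_div_ZI (hn : 0 < n) {a b u : ℝ} (hb : 0 < b) (hu : 0 < u) (hbu : b < u)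
    (hdual : Real.sinh (2 * a) * Real.sinh (2 * u) = 1) {g : ℕ → Fin n → ℝ}
    (hg : ∀ σ < 2, ∀ k, 0 < g σ k)
    (hcosh : ∀ σ < 2, ∀ k : Fin n, Real.cosh (g σ k) = Real.cosh (2 * u) * Real.cosh (2 * b) -
      Real.cos (Real.pi * (2 * k + σ : ℕ) / n) * (Real.sinh (2 * u) * Real.sinh (2 * b)))
    (m : ℕ) (hR : 0 < sectorTrace 1 (g 1) (m + 1)) (hR' : 0 ≤ sectorTrace 0 (g 0) (m + 1)) :
    1 - ZIm (m + 1) n a b / ZI (m + 1) n a b =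
      2 * sectorTrace 0 (g 0) (m + 1) /
        (sectorTrace 1 (g 1) (m + 1) + sectorTrace 0 (g 0) (m + 1)) := by
  set κ : ℝ := Real.exp a / Real.cosh u with hκ
  have hcu := Real.cosh_pos u
  have hc : κ * Real.cosh u = Real.exp a := div_mul_cancel₀ _ hcu.ne'
  have hs : κ * Real.sinh u = Real.exp (-a) := by
    have h1 : Real.sinh u * (Real.exp a * Real.exp a) = Real.cosh u := by
      have h2 : (Real.sinh u * (Real.exp a * Real.exp a) - Real.cosh u) *
          (Real.cosh u * (Real.exp a * Real.exp a) + Real.sinh u) = 0 := by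
        rw [Real.sinh_two_mul u, two_mul a, Real.sinh_eq, neg_add, Real.exp_add,
          Real.exp_add] at hdual
        have h3 : Real.exp a * Real.exp (-a) = 1 := by rw [← Real.exp_add]; simp
        have h4 := Real.cosh_sq u
        generalize Real.exp a = x at *
        generalize Real.exp (-a) = y at *
        have h5 : (x ^ 4 - 1) * (Real.sinh u * Real.cosh u) = x ^ 2 := by
          linear_combination x ^ 2 * hdual +
            (Real.sinh u * Real.cosh u) * (x * y + 1) * h3
        linear_combination h5 - x ^ 2 * h4
      refine sub_eq_zero.1 ((mul_eq_zero.1 h2).resolve_right ?_)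
      have := Real.sinh_pos_iff.2 hu
      positivity
    rw [hκ, Real.exp_neg, ← h1]
    have := Real.sinh_pos_iff.2 hu
    field_simp
  have hκ0 : 0 < κ := div_pos (Real.exp_pos a) hcu
  have hT := toLin_columnWeight (n := n) (κ := κ) (a := a) (u := u)
    (by rw [← Complex.ofReal_cosh]; exact_mod_cast hc)
    (by rw [← Complex.ofReal_sinh]; exact_mod_cast hs) b
  have hZ : (ZI (m + 1) n a b : ℂ) = (2⁻¹ : ℝ) ^ ((m + 1) * n) * ((κ ^ n) ^ (m + 1) : ℝ) *
      LinearMap.trace ℂ _ (transferOp n u b ^ (m + 1)) := by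
    rw [ZI_eq_trace, ← Matrix.trace_toLin'_eq, Matrix.toLin'_pow, hT, smul_pow, map_smul,
      transferOp, smul_eq_mul]
    push_cast
    ring
  have hZm : (ZIm (m + 1) n a b : ℂ) = (2⁻¹ : ℝ) ^ ((m + 1) * n) * ((κ ^ n) ^ (m + 1) : ℝ) *
      LinearMap.trace ℂ _ (transferOp n u b ^ (m + 1) * flipOp n n) := by
    rw [ZIm_eq_trace, ← Matrix.trace_toLin'_eq, Matrix.toLin'_mul, Matrix.toLin'_pow,
      toLin_columnWeight_neg, ← Module.End.mul_eq_comp, ← mul_assoc, ← pow_succ, hT, smul_pow,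
      smul_mul_assoc, map_smul, transferOp, smul_eq_mul]
    push_cast
    ring
  have hsec (σ : ℕ) (hσ : σ < 2) : LinearMap.trace ℂ _ (transferOp n u b ^ (m + 1)) -
      (-1) ^ σ * LinearMap.trace ℂ _ (transferOp n u b ^ (m + 1) * flipOp n n) =
      (sectorTrace σ (g σ) (m + 1) : ℝ) := by
    have hτ : (-(-1 : ℂ) ^ σ) * (-(-1) ^ σ) = 1 := by
      rw [neg_mul_neg, ← mul_pow]; simp
    have h1 := trace_transferOp_pow hn hτ u b (m + 1)
    obtain ⟨h2, h3⟩ := trace_twistedTransfer_pow hn hb hbu (hg σ hσ) (hcosh σ hσ) (m + 1)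
    rw [h2, h3] at h1
    rw [sub_eq_add_neg, ← neg_mul, h1, sectorTrace]
    push_cast
    ring
  have h0 := hsec 0 (by omega)
  have h1 := hsec 1 (by omega)
  set K : ℝ := (2⁻¹ : ℝ) ^ ((m + 1) * n) * (κ ^ n) ^ (m + 1) with hK
  have hK0 : 0 < K := by positivity
  have e1 : ZI (m + 1) n a b =
      K * ((sectorTrace 1 (g 1) (m + 1) + sectorTrace 0 (g 0) (m + 1)) / 2) := by
    have : (ZI (m + 1) n a b : ℂ) =
        K * ((sectorTrace 1 (g 1) (m + 1) + sectorTrace 0 (g 0) (m + 1)) / 2) := by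
      rw [hZ, ← h0, ← h1, hK]
      push_cast
      ring
    exact_mod_cast this
  have e2 : ZIm (m + 1) n a b =
      K * ((sectorTrace 1 (g 1) (m + 1) - sectorTrace 0 (g 0) (m + 1)) / 2) := by
    have : (ZIm (m + 1) n a b : ℂ) =
        K * ((sectorTrace 1 (g 1) (m + 1) - sectorTrace 0 (g 0) (m + 1)) / 2) := by
      rw [hZm, ← h0, ← h1, hK]
      push_cast
      ring
    exact_mod_cast this
  have h3 : sectorTrace 1 (g 1) (m + 1) + sectorTrace 0 (g 0) (m + 1) ≠ 0 := by positivity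
  rw [e1, e2]
  field_simp
  ring

end TwistedSectors

section AlternatingSum
open Finset Filter

lemma abs_second_difference_le {f : ℝ → ℝ} (hf : ContDiff ℝ 2 f) {s t M : ℝ}
    (hM : ∀ x ∈ Set.Icc s t, ‖deriv (deriv f) x‖ ≤ M) {x h : ℝ} (hh : 0 ≤ h) (hs : s ≤ x - h)
    (ht : x + h ≤ t) : |f (x + h) + f (x - h) - 2 * f x| ≤ M * h ^ 2 := by
  have h1 : Differentiable ℝ f := hf.differentiable two_ne_zero
  have h2 : Differentiable ℝ (deriv f) :=
    ((contDiff_succ_iff_deriv (n := 1)).1 hf).2.2.differentiable one_ne_zero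
  have hφ (y : ℝ) : HasDerivAt (fun r => f (x + r) - f (x - h + r))
      (deriv f (x + y) - deriv f (x - h + y)) y :=
    ((h1 _).hasDerivAt.comp_const_add x y).sub ((h1 _).hasDerivAt.comp_const_add (x - h) y)
  have hb : ∀ y ∈ Set.Icc 0 h, ‖deriv f (x + y) - deriv f (x - h + y)‖ ≤ M * h := by
    intro y hy
    have := (convex_Icc s t).norm_image_sub_le_of_norm_deriv_le (fun z _ => h2 z) hM
      (x := x - h + y) (y := x + y) ⟨by linarith [hy.1], by linarith [hy.2]⟩
      ⟨by linarith [hy.1], by linarith [hy.2]⟩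
    have e : x + y - (x - h + y) = h := by ring
    rwa [e, Real.norm_of_nonneg hh] at this
  have := (convex_Icc 0 h).norm_image_sub_le_of_norm_hasDerivWithin_le
    (fun y _ => (hφ y).hasDerivWithinAt) hb (Set.left_mem_Icc.2 hh) (Set.right_mem_Icc.2 hh)
  rw [Real.norm_eq_abs, sub_zero, Real.norm_of_nonneg hh] at this
  convert this using 1
  · congr 1
    simp only [sub_add_cancel, add_zero]
    ring
  · ring

lemma sum_alternating (c : ℕ → ℝ) (n : ℕ) :
    ∑ j ∈ range (2 * n), (-1 : ℝ) ^ (j + 1) * c j = ∑ k ∈ range n, (c (2 * k + 1) - c (2 * k)) := by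
  induction n with
  | zero => simp
  | succ n ih =>
    rw [show 2 * (n + 1) = 2 * n + 1 + 1 by ring, sum_range_succ, sum_range_succ, sum_range_succ,
      ih]
    have h : (-1 : ℝ) ^ (2 * n) = 1 := by rw [pow_mul]; simp
    linear_combination (c (2 * n + 1) - c (2 * n)) * h

lemma two_mul_sum_alternating {c : ℕ → ℝ} {n : ℕ} (hc : c (2 * n) = c 0) :
    2 * ∑ j ∈ range (2 * n), (-1 : ℝ) ^ (j + 1) * c j =
      ∑ k ∈ range n, -(c (2 * k + 2) + c (2 * k) - 2 * c (2 * k + 1)) := by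
  have h1 : ∑ k ∈ range n, (c (2 * k + 2) - c (2 * k)) = 0 := by
    have := sum_range_sub (fun k => c (2 * k)) n
    rw [hc, mul_zero, sub_self] at this
    exact this
  have h2 : ∑ k ∈ range n, -(c (2 * k + 2) + c (2 * k) - 2 * c (2 * k + 1)) =
      2 * ∑ k ∈ range n, (c (2 * k + 1) - c (2 * k)) -
        ∑ k ∈ range n, (c (2 * k + 2) - c (2 * k)) := by
    rw [mul_sum, ← sum_sub_distrib]
    exact sum_congr rfl fun k _ => by ring
  rw [sum_alternating, h2, h1, sub_zero]

lemma exists_abs_sum_alternating_le {f : ℝ → ℝ} (hf : ContDiff ℝ 2 f)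
    (hper : f (2 * Real.pi) = f 0) :
    ∃ C : ℝ, ∀ n : ℕ, 1 ≤ n →
      |∑ j ∈ range (2 * n), (-1 : ℝ) ^ (j + 1) * f (Real.pi * j / n)| ≤ C / n := by
  have h2 : Continuous (deriv (deriv f)) :=
    ((contDiff_succ_iff_deriv (n := 1)).1 hf).2.2.continuous_deriv le_rfl
  obtain ⟨M, hM⟩ := isCompact_Icc.exists_bound_of_continuousOn (s := Set.Icc 0 (2 * Real.pi))
    h2.continuousOn
  refine ⟨M * Real.pi ^ 2 / 2, fun n hn => ?_⟩
  have hn0 : (0 : ℝ) < n := by exact_mod_cast hn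
  have hpi := Real.pi_pos
  have key := two_mul_sum_alternating (c := fun j => f (Real.pi * j / n)) (n := n) (by
    have : Real.pi * ((2 * n : ℕ) : ℝ) / n = 2 * Real.pi := by push_cast; field_simp
    show f (Real.pi * ((2 * n : ℕ) : ℝ) / n) = f (Real.pi * ((0 : ℕ) : ℝ) / n)
    rw [this, hper]
    simp)
  have hb : |∑ k ∈ range n, -(f (Real.pi * ((2 * k + 2 : ℕ) : ℝ) / n) +
      f (Real.pi * ((2 * k : ℕ) : ℝ) / n) - 2 * f (Real.pi * ((2 * k + 1 : ℕ) : ℝ) / n))| ≤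
      ∑ k ∈ range n, M * (Real.pi / n) ^ 2 := by
    refine (abs_sum_le_sum_abs _ _).trans (sum_le_sum fun k hk => ?_)
    rw [abs_neg]
    have hk : (k : ℝ) + 1 ≤ n := by exact_mod_cast mem_range.1 hk
    have e1 : Real.pi * ((2 * k + 2 : ℕ) : ℝ) / n =
        Real.pi * ((2 * k + 1 : ℕ) : ℝ) / n + Real.pi / n := by push_cast; ring
    have e2 : Real.pi * ((2 * k : ℕ) : ℝ) / n =
        Real.pi * ((2 * k + 1 : ℕ) : ℝ) / n - Real.pi / n := by push_cast; ring
    have b1 : 0 ≤ Real.pi * ((2 * k : ℕ) : ℝ) / n := by positivity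
    have b2 : Real.pi * ((2 * k + 2 : ℕ) : ℝ) / n ≤ 2 * Real.pi := by
      rw [div_le_iff₀ hn0]
      push_cast
      nlinarith
    rw [e1] at b2 ⊢
    rw [e2] at b1 ⊢
    exact abs_second_difference_le hf hM (by positivity) b1 b2
  rw [← key, sum_const, card_range, nsmul_eq_mul, abs_mul, abs_two] at hb
  rw [le_div_iff₀ hn0]
  have : (n : ℝ) * (M * (Real.pi / n) ^ 2) = M * Real.pi ^ 2 / n := by field_simp
  rw [this, le_div_iff₀ hn0] at hb
  linarith

lemma contDiff_arcosh_comp {A B : ℝ} (h : 1 < A - |B|) :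
    ContDiff ℝ 2 fun x => Real.arcosh (A - Real.cos x * B) := by
  have h1 : ContDiff ℝ 2 fun x : ℝ => A - Real.cos x * B :=
    contDiff_const.sub (Real.contDiff_cos.mul contDiff_const)
  refine contDiff_iff_contDiffAt.2 fun x => ?_
  have hx : 1 < A - Real.cos x * B := by
    have : Real.cos x * B ≤ |B| := by
      refine (le_abs_self _).trans ?_
      rw [abs_mul]
      exact mul_le_of_le_one_left (abs_nonneg B) (Real.abs_cos_le_one x)
    linarith
  exact ContDiffAt.comp (g := Real.arcosh) (f := fun x => A - Real.cos x * B) x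
    (Real.contDiffAt_arcosh hx) h1.contDiffAt

end AlternatingSum

section RootLimit
open Finset Filter

lemma tendsto_rpow_inv_of_bounds {r : ℕ → ℝ} {t c c' : ℝ} (ht : 0 < t) (hc : 0 < c)
    (h : ∀ m, 1 ≤ m → c * t ^ m ≤ r m ∧ r m ≤ c' * t ^ m) :
    Tendsto (fun m : ℕ => r m ^ (m : ℝ)⁻¹) atTop (nhds t) := by
  have hc' : 0 < c' := by
    have := (h 1 le_rfl).1.trans (h 1 le_rfl).2
    exact hc.trans_le (le_of_mul_le_mul_right this (by positivity))
  have key {d : ℝ} (hd : 0 < d) :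
      Tendsto (fun m : ℕ => (d * t ^ m) ^ (m : ℝ)⁻¹) atTop (nhds t) := by
    have h1 : Tendsto (fun m : ℕ => d ^ (m : ℝ)⁻¹ * t) atTop (nhds (d ^ (0 : ℝ) * t)) :=
      (((Real.continuous_const_rpow hd.ne').tendsto 0).comp
        (tendsto_inv_atTop_nhds_zero_nat (𝕜 := ℝ))).mul_const t
    rw [Real.rpow_zero, one_mul] at h1
    refine h1.congr' ?_
    filter_upwards [eventually_ge_atTop 1] with m hm
    rw [Real.mul_rpow hd.le (by positivity), Real.pow_rpow_inv_natCast ht.le (by omega)]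
  refine tendsto_of_tendsto_of_tendsto_of_le_of_le' (key hc) (key hc') ?_ ?_
  · filter_upwards [eventually_ge_atTop 1] with m hm
    exact Real.rpow_le_rpow (by positivity) (h m hm).1 (by positivity)
  · filter_upwards [eventually_ge_atTop 1] with m hm
    exact Real.rpow_le_rpow ((by positivity : (0 : ℝ) ≤ c * t ^ m).trans (h m hm).1) (h m hm).2
      (by positivity)

lemma one_add_pow_le {x : ℝ} (hx : 0 ≤ x) (hx1 : x ≤ 1) (n : ℕ) : (1 + x) ^ n ≤ 1 + 3 ^ n * x := by
  induction n with
  | zero => simpa using hx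
  | succ n ih =>
    have h3 : (1 : ℝ) ≤ 3 ^ n := one_le_pow₀ (by norm_num)
    rw [pow_succ, pow_succ]
    refine (mul_le_mul_of_nonneg_right ih (by positivity)).trans ?_
    nlinarith [mul_nonneg hx (sub_nonneg.2 hx1), mul_nonneg hx (sub_nonneg.2 h3),
      mul_nonneg (mul_nonneg hx (sub_nonneg.2 hx1)) (zero_le_one.trans h3)]

variable {n : ℕ}

lemma prod_one_add_bounds {x : Fin n → ℝ} {y : ℝ} (k : Fin n) (hk : x k = y) (h0 : ∀ k, 0 ≤ x k)
    (hy : ∀ k, x k ≤ y) (hy1 : y ≤ 1) :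
    (1 + y ≤ ∏ k, (1 + x k) ∧ ∏ k, (1 + x k) ≤ 1 + 3 ^ n * y) ∧
      (1 - n * y ≤ ∏ k, (1 - x k) ∧ ∏ k, (1 - x k) ≤ 1 - y) ∧ 0 ≤ ∏ k, (1 - x k) := by
  have hy0 : 0 ≤ y := hk ▸ h0 k
  refine ⟨⟨?_, ?_⟩, ⟨?_, ?_⟩, prod_nonneg fun k _ => sub_nonneg.2 ((hy k).trans hy1)⟩
  · rw [← mul_prod_erase univ _ (mem_univ k), hk]
    exact le_mul_of_one_le_right (by linarith)
      (one_le_prod fun k _ => by linarith [h0 k])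
  · refine (prod_le_prod (fun k _ => by linarith [h0 k])
      (fun k _ => (by linarith [hy k] : 1 + x k ≤ 1 + y))).trans ?_
    rw [prod_const, card_univ, Fintype.card_fin]
    exact one_add_pow_le hy0 hy1 n
  · have h1 := one_add_mul_le_pow (a := -y) (by linarith) n
    have h2 : ∏ _k : Fin n, (1 - y) ≤ ∏ k, (1 - x k) :=
      prod_le_prod (fun k _ => by linarith) (fun k _ => by linarith [hy k])
    rw [prod_const, card_univ, Fintype.card_fin] at h2
    rw [← sub_eq_add_neg] at h1
    linarith
  · rw [← mul_prod_erase univ _ (mem_univ k), hk]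
    exact mul_le_of_le_one_right (by linarith)
      (prod_le_one (fun k _ => by linarith [hy k]) (fun k _ => by linarith [h0 k]))

lemma sectorTrace_zero_bounds {g : Fin n → ℝ} {γ : ℝ} (k : Fin n) (hk : g k = γ) (hγ : 0 ≤ γ)
    (h : ∀ k, γ ≤ g k) (m : ℕ) :
    2 * (Real.exp ((∑ k, g k) / 2) * Real.exp (-γ)) ^ m ≤ sectorTrace 0 g m ∧
      sectorTrace 0 g m ≤
        (3 ^ n + n) * (Real.exp ((∑ k, g k) / 2) * Real.exp (-γ)) ^ m := by
  obtain ⟨⟨h1, h2⟩, ⟨h3, h4⟩, -⟩ := prod_one_add_bounds (x := fun k => Real.exp (-g k) ^ m)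
    (y := Real.exp (-γ) ^ m) k (by rw [hk]) (fun k => by positivity)
    (fun k => pow_le_pow_left₀ (Real.exp_pos _).le (Real.exp_le_exp.2 (by linarith [h k])) m)
    (pow_le_one₀ (Real.exp_pos _).le (Real.exp_le_one_iff.2 (by linarith)))
  rw [sectorTrace, pow_zero, one_mul, mul_pow]
  have hC : 0 < Real.exp ((∑ k, g k) / 2) ^ m := by positivity
  constructor
  · rw [mul_left_comm]
    exact mul_le_mul_of_nonneg_left (by linarith) hC.le
  · rw [mul_left_comm]
    exact mul_le_mul_of_nonneg_left (by linarith) hC.le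

lemma sectorTrace_one_bounds {g : Fin n → ℝ} (h : ∀ k, 0 ≤ g k) (m : ℕ) :
    Real.exp ((∑ k, g k) / 2) ^ m ≤ sectorTrace 1 g m ∧
      sectorTrace 1 g m ≤ (2 ^ n + 1) * Real.exp ((∑ k, g k) / 2) ^ m := by
  have hx (k : Fin n) : Real.exp (-g k) ^ m ≤ 1 :=
    pow_le_one₀ (Real.exp_pos _).le (Real.exp_le_one_iff.2 (by linarith [h k]))
  have hx0 (k : Fin n) : 0 ≤ Real.exp (-g k) ^ m := by positivity
  have h1 : 1 ≤ ∏ k, (1 + Real.exp (-g k) ^ m) := one_le_prod fun k _ => by linarith [hx0 k]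
  have h2 : ∏ k, (1 + Real.exp (-g k) ^ m) ≤ 2 ^ n := by
    have : ∏ k, (1 + Real.exp (-g k) ^ m) ≤ ∏ _k : Fin n, (2 : ℝ) :=
      prod_le_prod (fun k _ => by linarith [hx0 k]) (fun k _ => by linarith [hx k])
    simpa using this
  have h3 : 0 ≤ ∏ k, (1 - Real.exp (-g k) ^ m) := prod_nonneg fun k _ => by linarith [hx k]
  have h4 : ∏ k, (1 - Real.exp (-g k) ^ m) ≤ 1 :=
    prod_le_one (fun k _ => by linarith [hx k]) (fun k _ => by linarith [hx0 k])
  have hC : 0 < Real.exp ((∑ k, g k) / 2) ^ m := by positivity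
  rw [sectorTrace, pow_one]
  constructor
  · exact le_mul_of_one_le_right hC.le (by linarith)
  · rw [mul_comm]
    exact mul_le_mul_of_nonneg_right (by linarith) hC.le

theorem tendsto_sector_ratio {g g' : Fin n → ℝ} {γ : ℝ} (k : Fin n) (hk : g k = γ) (hγ : 0 ≤ γ)
    (h : ∀ k, γ ≤ g k) (h' : ∀ k, 0 ≤ g' k) :
    Tendsto (fun m : ℕ => (2 * sectorTrace 0 g m / (sectorTrace 1 g' m + sectorTrace 0 g m)) ^
      (m : ℝ)⁻¹) atTop (nhds (Real.exp ((∑ k, g k) / 2 - (∑ k, g' k) / 2 - γ) /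
        max 1 (Real.exp ((∑ k, g k) / 2 - (∑ k, g' k) / 2 - γ)))) := by
  set ρ := Real.exp ((∑ k, g k) / 2) * Real.exp (-γ) with hρ
  set C := Real.exp ((∑ k, g' k) / 2) with hC
  have hρ0 : 0 < ρ := by positivity
  have hC0 : 0 < C := by positivity
  have e : Real.exp ((∑ k, g k) / 2 - (∑ k, g' k) / 2 - γ) = ρ / C := by
    rw [hρ, hC, ← Real.exp_add, ← Real.exp_sub]
    congr 1
    ring
  have e2 : ρ / C / max 1 (ρ / C) = ρ / max C ρ := by
    rw [← div_self hC0.ne', max_div_div_right hC0.le, div_div_div_cancel_right₀ hC0.ne']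
  rw [e, e2]
  have hM0 : 0 < max C ρ := lt_max_of_lt_left hC0
  refine tendsto_rpow_inv_of_bounds (c := 4 / (2 ^ n + 1 + (3 ^ n + n))) (c' := 2 * (3 ^ n + n))
    (by positivity) (by positivity) fun m _ => ?_
  obtain ⟨h1, h2⟩ := sectorTrace_zero_bounds k hk hγ h m
  obtain ⟨h3, h4⟩ := sectorTrace_one_bounds h' m
  rw [← hρ] at h1 h2
  rw [← hC] at h3 h4
  have hρm : 0 < ρ ^ m := by positivity
  have hCm : 0 < C ^ m := by positivity
  have hMm : 0 < max C ρ ^ m := by positivity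
  have hm1 : C ^ m ≤ max C ρ ^ m := pow_le_pow_left₀ hC0.le (le_max_left _ _) m
  have hm2 : ρ ^ m ≤ max C ρ ^ m := pow_le_pow_left₀ hρ0.le (le_max_right _ _) m
  have hlow : max C ρ ^ m ≤ sectorTrace 1 g' m + sectorTrace 0 g m := by
    rcases max_choice C ρ with hm | hm <;> rw [hm] <;> linarith
  have hup : sectorTrace 1 g' m + sectorTrace 0 g m ≤
      (2 ^ n + 1 + (3 ^ n + n)) * max C ρ ^ m := by
    have b1 : ((2 : ℝ) ^ n + 1) * C ^ m ≤ (2 ^ n + 1) * max C ρ ^ m :=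
      mul_le_mul_of_nonneg_left hm1 (by positivity)
    have b2 : ((3 : ℝ) ^ n + n) * ρ ^ m ≤ (3 ^ n + n) * max C ρ ^ m :=
      mul_le_mul_of_nonneg_left hm2 (by positivity)
    linarith
  rw [div_pow]
  constructor
  · rw [div_mul_div_comm]
    exact div_le_div₀ (by linarith) (by linarith) (by linarith) hup
  · rw [← mul_div_assoc]
    exact div_le_div₀ (by positivity) (by linarith) hMm hlow

end RootLimit

open Filter

/-- In the high-temperature regime `ā > b` of the square-lattice Ising model, the
alternating sum `S(L2) = Σ_{j=0}^{2L2−1} (−1)^{j+1} γ_j(L2)` tends to `0` as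
`L2 → ∞` (indeed `S(L2) = O(1/L2)`); consequently
`lim_{L2→∞} lim_{L1→∞} (1 − Z_Λ^{(−)}/Z_Λ)^{1/L1} = e^{−γ_0}` with
`γ_0 = 2(ā − b)` the exact inverse correlation length. -/
theorem ising_twisted_ratio_double_limit
    (a b : ℝ) (ha : 0 < a) (hb : 0 < b)
    (abar : ℝ) (habar : 0 < abar)
    (hdual : Real.sinh (2 * a) * Real.sinh (2 * abar) = 1)
    (hht : b < abar)
    (gam : ℕ → ℕ → ℝ)
    (hgam : ∀ L2, 0 < L2 → ∀ j < 2 * L2, 0 ≤ gam L2 j ∧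
      Real.cosh (gam L2 j) = Real.cosh (2 * abar) * Real.cosh (2 * b) -
        Real.cos (Real.pi * j / L2) * (Real.sinh (2 * abar) * Real.sinh (2 * b))) :
    Tendsto (fun L2 : ℕ =>
        ∑ j ∈ Finset.range (2 * L2), (-1 : ℝ) ^ (j + 1) * gam L2 j) atTop (nhds 0) ∧
      (∃ C : ℝ, ∀ L2 : ℕ, 1 ≤ L2 →
        |∑ j ∈ Finset.range (2 * L2), (-1 : ℝ) ^ (j + 1) * gam L2 j| ≤ C / L2) ∧
      ∃ E : ℕ → ℝ,
        (∀ L2 : ℕ, 1 ≤ L2 →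
          Tendsto (fun L1 : ℕ => (1 - ZIm L1 L2 a b / ZI L1 L2 a b) ^ ((L1 : ℝ))⁻¹)
            atTop (nhds (E L2))) ∧
        Tendsto E atTop (nhds (Real.exp (-(2 * (abar - b))))) := by
  have hB : 0 < Real.sinh (2 * abar) * Real.sinh (2 * b) :=
    mul_pos (Real.sinh_pos_iff.2 (by linarith)) (Real.sinh_pos_iff.2 (by linarith))
  have hcs : Real.cosh (2 * (abar - b)) = Real.cosh (2 * abar) * Real.cosh (2 * b) -
      Real.sinh (2 * abar) * Real.sinh (2 * b) := by
    rw [mul_sub, Real.cosh_sub]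
  have hγ : 0 < 2 * (abar - b) := by linarith
  have hγle (n : ℕ) (j : ℕ) (hj : j < 2 * n) : 2 * (abar - b) ≤ gam n j := by
    obtain ⟨h0, h1⟩ := hgam n (by omega) j hj
    rw [← abs_of_pos hγ, ← abs_of_nonneg h0, ← Real.cosh_le_cosh, hcs, h1]
    nlinarith [Real.cos_le_one (Real.pi * j / n)]
  have hγ0 (n : ℕ) (hn : 0 < n) : gam n 0 = 2 * (abar - b) := by
    obtain ⟨h0, h1⟩ := hgam n hn 0 (by omega)
    refine le_antisymm ?_ (hγle n 0 (by omega))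
    rw [← abs_of_pos hγ, ← abs_of_nonneg h0, ← Real.cosh_le_cosh, hcs, h1]
    simp
  have hbound : ∃ C : ℝ, ∀ L2 : ℕ, 1 ≤ L2 →
      |∑ j ∈ Finset.range (2 * L2), (-1 : ℝ) ^ (j + 1) * gam L2 j| ≤ C / L2 := by
    obtain ⟨C, hC⟩ := exists_abs_sum_alternating_le
      (contDiff_arcosh_comp (A := Real.cosh (2 * abar) * Real.cosh (2 * b))
        (B := Real.sinh (2 * abar) * Real.sinh (2 * b)) (by
          rw [abs_of_pos hB, ← hcs]
          exact Real.one_lt_cosh.2 hγ.ne')) (by simp)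
    refine ⟨C, fun n hn => ?_⟩
    convert hC n hn using 3 with j hj
    obtain ⟨h0, h1⟩ := hgam n hn j (Finset.mem_range.1 hj)
    rw [← h1, Real.arcosh_cosh h0]
  have hlim : Tendsto (fun L2 : ℕ =>
      ∑ j ∈ Finset.range (2 * L2), (-1 : ℝ) ^ (j + 1) * gam L2 j) atTop (nhds 0) := by
    obtain ⟨C, hC⟩ := hbound
    refine squeeze_zero_norm' ?_ (tendsto_const_div_atTop_nhds_zero_nat C)
    filter_upwards [eventually_ge_atTop 1] with n hn using hC n hn
  refine ⟨hlim, hbound, fun n => Real.exp (-(∑ j ∈ Finset.range (2 * n),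
      (-1 : ℝ) ^ (j + 1) * gam n j) / 2 - 2 * (abar - b)) /
    max 1 (Real.exp (-(∑ j ∈ Finset.range (2 * n),
      (-1 : ℝ) ^ (j + 1) * gam n j) / 2 - 2 * (abar - b))), fun n hn => ?_, ?_⟩
  · set g : ℕ → Fin n → ℝ := fun σ k => gam n (2 * k + σ) with hg
    have hlt {σ : ℕ} (hσ : σ < 2) (k : Fin n) : 2 * (k : ℕ) + σ < 2 * n := by omega
    have hgγ {σ : ℕ} (hσ : σ < 2) (k : Fin n) : 2 * (abar - b) ≤ g σ k := hγle n _ (hlt hσ k)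
    have hk : g 0 ⟨0, hn⟩ = 2 * (abar - b) := hγ0 n hn
    have hsum : (∑ k, g 0 k) / 2 - (∑ k, g 1 k) / 2 - 2 * (abar - b) =
        -(∑ j ∈ Finset.range (2 * n), (-1 : ℝ) ^ (j + 1) * gam n j) / 2 - 2 * (abar - b) := by
      rw [sum_alternating, Finset.sum_sub_distrib,
        ← Fin.sum_univ_eq_sum_range (fun k => gam n (2 * k + 1)),
        ← Fin.sum_univ_eq_sum_range (fun k => gam n (2 * k))]
      simp only [hg, add_zero]
      ring
    have ht := tendsto_sector_ratio ⟨0, hn⟩ hk hγ.le (hgγ two_pos)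
      (fun k => hγ.le.trans (hgγ one_lt_two k))
    rw [hsum] at ht
    refine ht.congr' ?_
    filter_upwards [eventually_ge_atTop 1] with m hm
    obtain ⟨m, rfl⟩ := Nat.exists_eq_add_of_le' hm
    rw [one_sub_ZIm_div_ZI hn hb habar hht hdual (g := g)
      (fun σ hσ k => hγ.trans_le (hgγ hσ k)) (fun σ hσ k => (hgam n hn _ (hlt hσ k)).2) m
      (lt_of_lt_of_le (by positivity)
        (sectorTrace_one_bounds (fun k => hγ.le.trans (hgγ one_lt_two k)) (m + 1)).1)
      (le_trans (by positivity)
        (sectorTrace_zero_bounds ⟨0, hn⟩ hk hγ.le (hgγ two_pos) (m + 1)).1)]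
  · have h1 : Tendsto (fun n : ℕ => Real.exp (-(∑ j ∈ Finset.range (2 * n),
        (-1 : ℝ) ^ (j + 1) * gam n j) / 2 - 2 * (abar - b))) atTop
        (nhds (Real.exp (-(2 * (abar - b))))) := by
      have := (Real.continuous_exp.tendsto _).comp
        ((hlim.neg.div_const 2).sub_const (2 * (abar - b)))
      simpa only [Function.comp_def, neg_zero, zero_div, zero_sub] using this
    have h2 := h1.div (tendsto_const_nhds.max h1) (lt_max_of_lt_left one_pos).ne'
    rwa [max_eq_left (Real.exp_le_one_iff.2 (by linarith)), div_one] at h2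

end TYIsing
end

section
/- For all t, t_1 ∈ (−1,1), with A_0 = (1 + t² t_1)² + (t_1 + t²)² + 2t²(1 + t_1)², A = 2(1 − t_1²)(1 − t²) t / A_0 and B = 2 t_1 (1 − t²)² / A_0, one has A_0 > 0, |B| < 1 and g(B) ≥ |A|, where g(x) = √(−2x(1+x)) for −1 < x < −1/3 and g(x) = (1−x)/2 for −1/3 ≤ x < 1. -/
/-!
Quantities from the Wu–Hu exact solution of the anisotropic triangular-lattice Ising
model: `t1 = tanh(J1/kT)` (vertical bonds), `t = tanh(J/kT)` (the two other bond
directions), the coefficients `A0, A, B`, the products `Ω_{μν}`, the periodic and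
horizontally-antiperiodic partition-function combinations, and the function `g`
entering the decay rate `ρ = arccosh(g(B)/|A|)`.
-/

namespace TYTri

/-- The function `g` of (the definition of) the decay rate:
`g(x) = √(−2x(1+x))` for `−1 < x < −1/3` and `g(x) = (1−x)/2` for `−1/3 ≤ x < 1`. -/
noncomputable def gfun (x : ℝ) : ℝ :=
  if x < -(1 / 3 : ℝ) then Real.sqrt (-(2 * x) * (1 + x)) else (1 - x) / 2

/-- `A₀ = (1 + t² t₁)² + (t₁ + t²)² + 2t²(1 + t₁)²`. -/
noncomputable def A0f (t t1 : ℝ) : ℝ :=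
  (1 + t ^ 2 * t1) ^ 2 + (t1 + t ^ 2) ^ 2 + 2 * t ^ 2 * (1 + t1) ^ 2

/-- `A = 2(1 − t₁²)(1 − t²) t / A₀`. -/
noncomputable def Af (t t1 : ℝ) : ℝ := 2 * (1 - t1 ^ 2) * (1 - t ^ 2) * t / A0f t t1

/-- `B = 2 t₁ (1 − t²)² / A₀`. -/
noncomputable def Bf (t t1 : ℝ) : ℝ := 2 * t1 * (1 - t ^ 2) ^ 2 / A0f t t1

/-- The Wu–Hu product
`Ω_{μν} = A₀^{MN/2} ∏_{p<M} ∏_{q<N} [1 − B cos(2π(p+μ)/M) − A cos(2π(q+ν)/N)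
  − A cos(2π(p+μ)/M − 2π(q+ν)/N)]^{1/2}`. -/
noncomputable def Om (t t1 : ℝ) (M N : ℕ) (μ ν : ℝ) : ℝ :=
  A0f t t1 ^ ((M * N : ℝ) / 2) *
    ∏ p ∈ Finset.range M, ∏ q ∈ Finset.range N,
      Real.sqrt (1 - Bf t t1 * Real.cos (2 * Real.pi * (p + μ) / M) -
        Af t t1 * Real.cos (2 * Real.pi * (q + ν) / N) -
        Af t t1 * Real.cos (2 * Real.pi * (p + μ) / M - 2 * Real.pi * (q + ν) / N))

/-- The periodic partition-function combination
`Z = Ω_{½,½} + Ω_{½,0} + Ω_{0,½} − Ω_{0,0}` (disordered phase). -/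
noncomputable def Zper (t t1 : ℝ) (M N : ℕ) : ℝ :=
  Om t t1 M N (1 / 2) (1 / 2) + Om t t1 M N (1 / 2) 0 + Om t t1 M N 0 (1 / 2) -
    Om t t1 M N 0 0

/-- The horizontally-antiperiodic partition-function combination
`Z^{(−)} = Ω_{½,½} + Ω_{½,0} − Ω_{0,½} + Ω_{0,0}` (disordered phase). -/
noncomputable def Zap (t t1 : ℝ) (M N : ℕ) : ℝ :=
  Om t t1 M N (1 / 2) (1 / 2) + Om t t1 M N (1 / 2) 0 - Om t t1 M N 0 (1 / 2) +
    Om t t1 M N 0 0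

/-- `ρ = arccosh(g(B)/|A|) = log(g(B)/|A| + √((g(B)/|A|)² − 1))`. -/
noncomputable def rhoTri (t t1 : ℝ) : ℝ :=
  Real.log (gfun (Bf t t1) / |Af t t1| +
    Real.sqrt ((gfun (Bf t t1) / |Af t t1|) ^ 2 - 1))


end TYTri

namespace TYTri

theorem A0f_add_eq (t t1 : ℝ) :
    A0f t t1 + 2 * t1 * (1 - t ^ 2) ^ 2 = ((1 + t1) * (1 + t ^ 2)) ^ 2 := by
  unfold A0f; ring

theorem A0f_sub_eq (t t1 : ℝ) :
    A0f t t1 - 2 * t1 * (1 - t ^ 2) ^ 2 =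
      ((1 - t1) * (1 - t ^ 2)) ^ 2 + (2 * t * (1 + t1)) ^ 2 := by
  unfold A0f; ring

theorem A0f_sub_sub_eq (t t1 : ℝ) :
    A0f t t1 - 2 * t1 * (1 - t ^ 2) ^ 2 - 4 * (1 - t1 ^ 2) * (1 - t ^ 2) * t =
      ((1 - 2 * t - t ^ 2) - t1 * (1 + 2 * t - t ^ 2)) ^ 2 := by
  unfold A0f; ring

theorem A0f_sub_add_eq (t t1 : ℝ) :
    A0f t t1 - 2 * t1 * (1 - t ^ 2) ^ 2 + 4 * (1 - t1 ^ 2) * (1 - t ^ 2) * t =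
      ((1 + 2 * t - t ^ 2) - t1 * (1 - 2 * t - t ^ 2)) ^ 2 := by
  unfold A0f; ring

theorem le_neg_sq_of_A0f_add_neg {t t1 : ℝ} (ht : t ^ 2 < 1)
    (h : A0f t t1 + 6 * t1 * (1 - t ^ 2) ^ 2 < 0) : t1 ≤ -t ^ 2 := by
  by_contra! hlt
  have hslope : 0 ≤ (1 - t ^ 2) * (6 + 2 * (t ^ 2) ^ 2) + (t1 + t ^ 2) * (1 + t ^ 2) ^ 2 :=
    add_nonneg (mul_nonneg (by linarith) (by positivity))
      (mul_nonneg (by linarith) (by positivity))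
  have hprod := mul_nonneg (by linarith : 0 ≤ t1 + t ^ 2) hslope
  have hid : A0f t t1 + 6 * t1 * (1 - t ^ 2) ^ 2 = ((1 - t ^ 2) ^ 2) ^ 2 +
      (t1 + t ^ 2) * ((1 - t ^ 2) * (6 + 2 * (t ^ 2) ^ 2) +
        (t1 + t ^ 2) * (1 + t ^ 2) ^ 2) := by
    unfold A0f; ring
  linarith [sq_nonneg ((1 - t ^ 2) ^ 2)]

/-- For all `t, t1 ∈ (−1, 1)`: `A₀ > 0`, `|B| < 1` and `g(B) ≥ |A|`.
Thus `ρ = arccosh(g(B)/|A|)` is well defined throughout the disordered phase, with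
equality `g(B) = |A|` exactly on the critical line. -/
theorem triangular_ising_coefficient_bounds
    (t t1 : ℝ) (ht : t ∈ Set.Ioo (-1 : ℝ) 1) (ht1 : t1 ∈ Set.Ioo (-1 : ℝ) 1) :
    0 < A0f t t1 ∧ |Bf t t1| < 1 ∧ |Af t t1| ≤ gfun (Bf t t1) := by
  obtain ⟨hs0, hs1⟩ := ht1
  have hu : t ^ 2 < 1 := by nlinarith [ht.1, ht.2]
  have hadd : 0 < A0f t t1 + 2 * t1 * (1 - t ^ 2) ^ 2 := by
    rw [A0f_add_eq]
    have : 0 < 1 + t1 := by linarith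
    positivity
  have hsub : 0 < A0f t t1 - 2 * t1 * (1 - t ^ 2) ^ 2 := by
    rw [A0f_sub_eq]
    have : 0 < 1 - t1 := by linarith
    have : 0 < 1 - t ^ 2 := by linarith
    positivity
  have hA0 : 0 < A0f t t1 := by linarith
  refine ⟨hA0, ?_, ?_⟩
  · rw [Bf, abs_lt, lt_div_iff₀ hA0, div_lt_one hA0]
    constructor <;> linarith
  unfold gfun
  split_ifs with hB
  · apply Real.abs_le_sqrt
    have hs : t1 ≤ -t ^ 2 := by
      refine le_neg_sq_of_A0f_add_neg hu ?_
      rw [Bf, div_lt_iff₀ hA0] at hB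
      linarith
    have hfac : 0 ≤ -(t1 + t ^ 2) * (1 + t ^ 2 * t1) :=
      mul_nonneg (by linarith) (by nlinarith [sq_nonneg t])
    have hrhs : -(2 * Bf t t1) * (1 + Bf t t1) =
        -(4 * t1 * (1 - t ^ 2) ^ 2) * ((1 + t1) * (1 + t ^ 2)) ^ 2 / A0f t t1 ^ 2 := by
      rw [← A0f_add_eq, Bf]
      field_simp
      ring
    rw [hrhs, Af, div_pow]
    gcongr
    have := mul_nonneg (sq_nonneg (2 * (1 - t ^ 2) * (1 + t1))) hfac
    linear_combination this
  · have hrhs : (1 - Bf t t1) / 2 =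
        (A0f t t1 - 2 * t1 * (1 - t ^ 2) ^ 2) / 2 / A0f t t1 := by
      rw [Bf]
      field_simp
    rw [hrhs, Af, abs_div, abs_of_pos hA0]
    gcongr
    rw [abs_le]
    constructor
    · linarith [A0f_sub_add_eq t t1, sq_nonneg ((1 + 2 * t - t ^ 2) - t1 * (1 - 2 * t - t ^ 2))]
    · linarith [A0f_sub_sub_eq t t1, sq_nonneg ((1 - 2 * t - t ^ 2) - t1 * (1 + 2 * t - t ^ 2))]

end TYTri
end
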